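/- If Γ is a finite simplicial graph focused at a vertex c with trivial graph automorphism group and n = |V| vertices, then Aut(A_Γ) ≅ PCT ⋊ I_Γ: the subgroup PCT is normal in Aut(A_Γ), the inversion subgroup I_Γ is isomorphic to (ℤ/2ℤ)^n, PCT ∩ I_Γ is trivial, and PCT and I_Γ together generate Aut(A_Γ). Moreover Inn(A_Γ) ≤ PCT. -/

import Mathlib

noncomputable section

/-- The subgroup of inner automorphisms inside `MulAut G`. -/
def Inn (G : Type) [Group G] : Subgroup (MulAut G) :=
  (MulAut.conj : G →* MulAut G).range

instance Inn.normal (G : Type) [Group G] : (Inn G).Normal := by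
  constructor
  rintro x ⟨g, rfl⟩ φ
  refine ⟨φ g, ?_⟩
  ext h
  simp [MulAut.mul_apply, MulAut.conj_apply, map_mul, map_inv]

/-- The outer automorphism group of `G`. -/
abbrev Out (G : Type) [Group G] := MulAut G ⧸ Inn G

/-- The set of commutator relators defining the RAAG of a graph. -/
def raagRels {V : Type} (G : SimpleGraph V) : Set (FreeGroup V) :=
  {r | ∃ u v : V, G.Adj u v ∧
    r = FreeGroup.of u * FreeGroup.of v * (FreeGroup.of u)⁻¹ * (FreeGroup.of v)⁻¹}

/-- The right-angled Artin group of a graph. -/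
abbrev RAAG {V : Type} (G : SimpleGraph V) := PresentedGroup (raagRels G)

/-- The standard generator of `RAAG G` corresponding to a vertex. -/
def gen {V : Type} (G : SimpleGraph V) (v : V) : RAAG G := PresentedGroup.of v

/-- The star of a vertex: the vertex together with its neighbours. -/
def star {V : Type} (G : SimpleGraph V) (v : V) : Set V := insert v (G.neighborSet v)

/-- `u` dominates `v` if `lk(v) ⊆ st(u)`. -/
def Dominates {V : Type} (G : SimpleGraph V) (u v : V) : Prop :=
  G.neighborSet v ⊆ star G u

/-- A graph has trivial automorphism group. -/
def TrivialAut {V : Type} (G : SimpleGraph V) : Prop := ∀ e : G ≃g G, ∀ v, e v = v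

/-- A graph is focused at a vertex `c`. -/
def Focused {V : Type} (G : SimpleGraph V) (c : V) : Prop :=
  (∀ u v : V, u ≠ v → Dominates G u v → u = c) ∧
  ∀ v : V, v ≠ c → (G.induce (star G v)ᶜ).Connected

/-- A graph is austere. -/
def Austere {V : Type} (G : SimpleGraph V) : Prop :=
  TrivialAut G ∧ (∀ u v : V, u ≠ v → ¬Dominates G u v) ∧
  ∀ v : V, (G.induce (star G v)ᶜ).Connected

/-- `P` is (the vertex set of) a connected component of the induced subgraph on `s`. -/
def IsCompOf {V : Type} (G : SimpleGraph V) (s : Set V) (P : Set V) : Prop :=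
  ∃ x : s, P = Subtype.val '' {y : s | (G.induce s).Reachable x y}

/-- `φ` is the inversion at the vertex `v`. -/
def IsInversion {V : Type} (G : SimpleGraph V) (φ : MulAut (RAAG G)) (v : V) : Prop :=
  φ (gen G v) = (gen G v)⁻¹ ∧ ∀ w : V, w ≠ v → φ (gen G w) = gen G w

/-- `φ` is the transvection `τ_{uv}` (`v ↦ uv`). -/
def IsTransvection {V : Type} (G : SimpleGraph V) (φ : MulAut (RAAG G)) (u v : V) : Prop :=
  u ≠ v ∧ Dominates G u v ∧ φ (gen G v) = gen G u * gen G v ∧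
    ∀ w : V, w ≠ v → φ (gen G w) = gen G w

/-- `φ` is the partial conjugation `χ_{v,P}`. -/
def IsPartialConj {V : Type} (G : SimpleGraph V) (φ : MulAut (RAAG G)) (v : V) (P : Set V) :
    Prop :=
  IsCompOf G (star G v)ᶜ P ∧ (∀ u ∈ P, φ (gen G u) = gen G v * gen G u * (gen G v)⁻¹) ∧
    ∀ w : V, w ∉ P → φ (gen G w) = gen G w

/-- The subgroup `I_Γ` of `Aut(A_Γ)` generated by the inversions. -/
def InvSubgroup {V : Type} (G : SimpleGraph V) : Subgroup (MulAut (RAAG G)) :=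
  Subgroup.closure {φ | ∃ v, IsInversion G φ v}

/-- The subgroup `PCT` of `Aut(A_Γ)` generated by transvections and partial conjugations. -/
def PCT {V : Type} (G : SimpleGraph V) : Subgroup (MulAut (RAAG G)) :=
  Subgroup.closure {φ | (∃ u v, IsTransvection G φ u v) ∨ ∃ v P, IsPartialConj G φ v P}

/-- The number `l` of vertices dominated by but not adjacent to `c`. -/
def lInv {V : Type} (G : SimpleGraph V) (c : V) : ℕ :=
  Nat.card {v : V | v ≠ c ∧ Dominates G c v ∧ ¬G.Adj c v}

/-- The number `m` of vertices (other than `c`) dominated by `c`. -/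
def mInv {V : Type} (G : SimpleGraph V) (c : V) : ℕ :=
  Nat.card {v : V | v ≠ c ∧ Dominates G c v}

/-- The number `k` of connected components of `Γ \ st(c)`. -/
def kInv {V : Type} (G : SimpleGraph V) (c : V) : ℕ :=
  Nat.card ((G.induce (star G c)ᶜ).ConnectedComponent)

/-- `GL_n(ℤ)`. -/
abbrev GLZ (n : ℕ) := Matrix.GeneralLinearGroup (Fin n) ℤ

/-- `PGL_n(ℤ)`, the quotient of `GL_n(ℤ)` by its centre `{±I}`. -/
abbrev PGLZ (n : ℕ) := GLZ n ⧸ Subgroup.center (GLZ n)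

/-- The principal level 2 congruence subgroup `Λ_l[2]` of `GL_l(ℤ)`. -/
def congr2 (l : ℕ) : Subgroup (GLZ l) :=
  (Matrix.GeneralLinearGroup.map (Int.castRingHom (ZMod 2)) :
    GLZ l →* Matrix.GeneralLinearGroup (Fin l) (ZMod 2)).ker

/-- The matrix `(1 1 / 0 -1)`. -/
def Bmat : Matrix (Fin 2) (Fin 2) ℤ := !![1, 1; 0, -1]

/-- A block-diagonal `2l × 2l` matrix whose `i`th `2 × 2` diagonal block is
`Bmat` if `ε i` and the identity otherwise. -/
def Lmat (l : ℕ) (ε : Fin l → Bool) : Matrix (Fin l × Fin 2) (Fin l × Fin 2) ℤ :=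
  fun a b =>
    if a.1 = b.1 then (if ε a.1 then Bmat a.2 b.2 else (1 : Matrix (Fin 2) (Fin 2) ℤ) a.2 b.2)
    else 0

/-- `GL_{2l}(ℤ)`, with rows and columns indexed by `Fin l × Fin 2`. -/
abbrev GL2l (l : ℕ) := Matrix.GeneralLinearGroup (Fin l × Fin 2) ℤ

/-- The subgroup `𝓛 ≤ GL_{2l}(ℤ)`. -/
def scriptL (l : ℕ) : Subgroup (GL2l l) :=
  Subgroup.closure {M : GL2l l |
    ∃ ε : Fin l → Bool, (M : Matrix (Fin l × Fin 2) (Fin l × Fin 2) ℤ) = Lmat l ε}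

/-- The index type realizing the block decomposition `d = 2l + p + q`. -/
abbrev BIdx (l p q : ℕ) := (Fin l × Fin 2) ⊕ (Fin p ⊕ Fin q)

/-- The block-diagonal matrix `Diag(D₁, D₂, ε·I_q)` with `D₁ ∈ 𝓛` given by `ε1`,
`D₂` diagonal with entries `d2`, and `ε = e`. -/
def Dmat (l p q : ℕ) (ε1 : Fin l → Bool) (d2 : Fin p → ℤˣ) (e : ℤˣ) :
    Matrix (BIdx l p q) (BIdx l p q) ℤ := fun a b =>
  match a, b with
  | Sum.inl a, Sum.inl b => Lmat l ε1 a b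
  | Sum.inr (Sum.inl i), Sum.inr (Sum.inl j) => if i = j then (d2 i : ℤ) else 0
  | Sum.inr (Sum.inr i), Sum.inr (Sum.inr j) => if i = j then (e : ℤ) else 0
  | _, _ => 0

/-- The subgroup `D ≤ GL_d(ℤ)` generated by `−I_d` and the block-diagonal matrices
`Diag(D₁, D₂, ε·I_q)`. -/
def DSub (l p q : ℕ) : Subgroup (Matrix.GeneralLinearGroup (BIdx l p q) ℤ) :=
  Subgroup.closure
    ({M | (M : Matrix (BIdx l p q) (BIdx l p q) ℤ) = -1} ∪
     {M | ∃ ε1 d2 e, (M : Matrix (BIdx l p q) (BIdx l p q) ℤ) = Dmat l p q ε1 d2 e})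

namespace RAAG

variable {V : Type} {G : SimpleGraph V} {H : Type*} [Group H]

theorem mem_star {u w : V} : w ∈ _root_.star G u ↔ w = u ∨ G.Adj u w := Iff.rfl

theorem commute_gen {u v : V} (h : G.Adj u v) : Commute (gen G u) (gen G v) := by
  have h1 : PresentedGroup.mk (raagRels G) (FreeGroup.of u * FreeGroup.of v *
      (FreeGroup.of u)⁻¹ * (FreeGroup.of v)⁻¹) = 1 :=
    PresentedGroup.one_of_mem ⟨u, v, h, rfl⟩
  simp only [map_mul, map_inv] at h1
  have h2 : gen G u * gen G v * (gen G u)⁻¹ * (gen G v)⁻¹ = 1 := h1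
  rwa [mul_inv_eq_one, mul_inv_eq_iff_eq_mul] at h2

/-- The homomorphism out of a right-angled Artin group determined by the images of the
generators. -/
def lift (f : V → H) (hf : ∀ u v, G.Adj u v → Commute (f u) (f v)) : RAAG G →* H :=
  PresentedGroup.toGroup (f := f) (by
    rintro r ⟨u, v, h, rfl⟩
    simp [(hf u v h).eq])

@[simp]
theorem lift_gen (f : V → H) (hf : ∀ u v, G.Adj u v → Commute (f u) (f v)) (v : V) :
    lift f hf (gen G v) = f v :=
  PresentedGroup.toGroup.of _

theorem hom_ext {f g : RAAG G →* H} (h : ∀ v, f (gen G v) = g (gen G v)) : f = g :=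
  PresentedGroup.ext h

theorem closure_gen : Subgroup.closure (Set.range (gen G)) = ⊤ :=
  PresentedGroup.closure_range_of _

theorem aut_ext {f g : MulAut (RAAG G)} (h : ∀ v, f (gen G v) = g (gen G v)) : f = g := by
  have : f.toMonoidHom = g.toMonoidHom := hom_ext h
  ext x
  exact DFunLike.congr_fun this x

/-- The automorphism with prescribed values on the generators, given prescribed values of the
inverse. -/
def mkAut (f g : RAAG G →* RAAG G) (hfg : ∀ v, f (g (gen G v)) = gen G v)
    (hgf : ∀ v, g (f (gen G v)) = gen G v) : MulAut (RAAG G) :=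
  MonoidHom.toMulEquiv f g (hom_ext hgf) (hom_ext hfg)

@[simp]
theorem mkAut_apply (f g : RAAG G →* RAAG G) (hfg hgf) (x : RAAG G) :
    mkAut f g hfg hgf x = f x := rfl

open Classical in
/-- The exponent sum of the generator `w`, as a homomorphism. -/
def expHom (w : V) : RAAG G →* Multiplicative ℤ :=
  lift (fun v => if v = w then Multiplicative.ofAdd 1 else 1) fun _ _ _ => Commute.all _ _

/-- The exponent sum of the generator `w`. -/
def expo (w : V) (x : RAAG G) : ℤ := Multiplicative.toAdd (expHom w x)

@[simp] theorem expo_mul (w : V) (x y : RAAG G) : expo w (x * y) = expo w x + expo w y := by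
  simp [expo]
@[simp] theorem expo_one (w : V) : expo w (1 : RAAG G) = 0 := by simp [expo]
@[simp] theorem expo_inv (w : V) (x : RAAG G) : expo w x⁻¹ = -expo w x := by simp [expo]
@[simp] theorem expo_zpow (w : V) (x : RAAG G) (n : ℤ) : expo w (x ^ n) = n * expo w x := by
  simp [expo]
@[simp] theorem expo_gen_self (w : V) : expo w (gen G w) = 1 := by simp [expo, expHom]
theorem expo_gen_of_ne {v w : V} (h : v ≠ w) : expo w (gen G v) = 0 := by
  simp [expo, expHom, h]

open Classical in
theorem expo_gen (v w : V) : expo w (gen G v) = if v = w then 1 else 0 := by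
  split_ifs with h
  · subst h; simp
  · exact expo_gen_of_ne h

open Classical in
/-- The retraction onto the standard subgroup generated by `S`. -/
def ret (S : Set V) : RAAG G →* RAAG G :=
  lift (fun v => if v ∈ S then gen G v else 1) fun u v h => by
    split_ifs <;> simp [commute_gen h]

theorem ret_gen_mem {S : Set V} {v : V} (h : v ∈ S) : ret S (gen G v) = gen G v := by
  simp [ret, h]
theorem ret_gen_notMem {S : Set V} {v : V} (h : v ∉ S) : ret S (gen G v) = 1 := by
  simp [ret, h]

/-- The standard subgroup generated by `S`. -/
def par (G : SimpleGraph V) (S : Set V) : Subgroup (RAAG G) := Subgroup.closure (gen G '' S)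

theorem gen_mem_par {S : Set V} {v : V} (h : v ∈ S) : gen G v ∈ par G S :=
  Subgroup.subset_closure ⟨v, h, rfl⟩

theorem hom_mem_of_gen (f : RAAG G →* H) (K : Subgroup H) (h : ∀ v, f (gen G v) ∈ K)
    (x : RAAG G) : f x ∈ K := by
  have : Subgroup.closure (Set.range (gen G)) ≤ K.comap f := by
    rw [Subgroup.closure_le]
    rintro _ ⟨v, rfl⟩
    exact h v
  exact this (by simp [closure_gen])

theorem par_le {S : Set V} {K : Subgroup (RAAG G)} (h : ∀ v ∈ S, gen G v ∈ K) : par G S ≤ K := by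
  rw [par, Subgroup.closure_le]
  rintro _ ⟨v, hv, rfl⟩
  exact h v hv

theorem eqOn_par {S : Set V} {f g : RAAG G →* H} (h : ∀ v ∈ S, f (gen G v) = g (gen G v))
    {x : RAAG G} (hx : x ∈ par G S) : f x = g x :=
  par_le (K := f.eqLocus g) h hx

theorem ret_mem_par (S : Set V) (x : RAAG G) : ret S x ∈ par G S := by
  refine hom_mem_of_gen _ _ (fun v => ?_) x
  by_cases h : v ∈ S
  · rw [ret_gen_mem h]; exact gen_mem_par h
  · rw [ret_gen_notMem h]; exact one_mem _

theorem ret_eq_self {S : Set V} {x : RAAG G} (hx : x ∈ par G S) : ret S x = x :=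
  eqOn_par (g := MonoidHom.id _) (fun _ hv => ret_gen_mem hv) hx

theorem par_mono {S T : Set V} (h : S ⊆ T) : par G S ≤ par G T :=
  par_le fun _ hv => gen_mem_par (h hv)

theorem ret_mem_par_inter {S T : Set V} {x : RAAG G} (hx : x ∈ par G T) :
    ret S x ∈ par G (S ∩ T) := by
  refine par_le (K := (par G (S ∩ T)).comap (ret S)) (fun v hv => ?_) hx
  rw [Subgroup.mem_comap]
  by_cases h : v ∈ S
  · rw [ret_gen_mem h]; exact gen_mem_par ⟨h, hv⟩
  · rw [ret_gen_notMem h]; exact one_mem _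

theorem mem_par_inter {S T : Set V} {x : RAAG G} (hS : x ∈ par G S) (hT : x ∈ par G T) :
    x ∈ par G (S ∩ T) := by
  have := ret_mem_par_inter (S := S) hT
  rwa [ret_eq_self hS] at this

theorem par_univ : par G Set.univ = ⊤ := by rw [par, Set.image_univ, closure_gen]

theorem mem_par_compl_finset [DecidableEq V] (F : Finset V) {x : RAAG G}
    (h : ∀ v ∈ F, x ∈ par G {v}ᶜ) : x ∈ par G (F : Set V)ᶜ := by
  induction F using Finset.induction_on with
  | empty => simp [par_univ]
  | insert a s ha ih =>
    have := mem_par_inter (h a (by simp)) (ih fun v hv => h v (by simp [hv]))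
    convert this using 2
    ext y; simp

theorem expo_eq_zero_of_mem_par {S : Set V} {w : V} (hw : w ∉ S) {x : RAAG G}
    (hx : x ∈ par G S) : expo w x = 0 := by
  have : expHom w x = (1 : RAAG G →* Multiplicative ℤ) x :=
    eqOn_par (fun v hv => by
      have : v ≠ w := fun h => hw (h ▸ hv)
      simp [expHom, this]) hx
  simp [expo, this]

theorem expo_ret {S : Set V} {w : V} (hw : w ∈ S) (x : RAAG G) : expo w (ret S x) = expo w x := by
  have : (expHom w).comp (ret S) = expHom (G := G) w := by
    refine hom_ext fun v => ?_
    by_cases hv : v ∈ S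
    · simp [ret_gen_mem hv]
    · have : v ≠ w := fun h => hv (h ▸ hw)
      simp [ret_gen_notMem hv, expHom, this]
  simp only [expo, ← DFunLike.congr_fun this x, MonoidHom.comp_apply]

theorem expo_hom [Fintype V] (f : RAAG G →* RAAG G) (w : V) (x : RAAG G) :
    expo w (f x) = ∑ u, expo u x * expo w (f (gen G u)) := by
  have : (expHom w).comp f =
      ∏ u, (zpowGroupHom (expo w (f (gen G u)))).comp (expHom (G := G) u) := by
    refine hom_ext fun v => ?_
    apply Multiplicative.toAdd.injective
    classical
    rw [MonoidHom.finsetProd_apply, toAdd_prod]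
    simp only [MonoidHom.comp_apply, zpowGroupHom_apply, toAdd_zpow]
    change expo w (f (gen G v)) = ∑ u, expo w (f (gen G u)) * expo u (gen G v)
    simp [expo_gen]
  have h2 := congrArg Multiplicative.toAdd (DFunLike.congr_fun this x)
  rw [MonoidHom.finsetProd_apply, toAdd_prod] at h2
  simp only [MonoidHom.comp_apply, zpowGroupHom_apply, toAdd_zpow, smul_eq_mul] at h2
  simpa only [expo, mul_comm] using h2

end RAAG

namespace FreeGroup

variable {X Y : Type*}

theorem norm_lift_le [DecidableEq X] [DecidableEq Y] (f : X → FreeGroup Y)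
    (hf : ∀ x, (f x).norm ≤ 1) (g : FreeGroup X) : (FreeGroup.lift f g).norm ≤ g.norm := by
  suffices h : ∀ L : List (X × Bool), (FreeGroup.lift f (mk L)).norm ≤ L.length by
    simpa [norm, mk_toWord] using h g.toWord
  intro L
  induction L with
  | nil => simp [← one_eq_mk]
  | cons a L ih =>
    rw [← List.singleton_append, ← mul_mk, _root_.map_mul]
    refine (norm_mul_le _ _).trans ?_
    have : (FreeGroup.lift f (mk [a])).norm ≤ 1 := by
      rcases a with ⟨x, b⟩
      cases b <;> simp [lift_mk, hf x]
    simp only [List.length_append, List.length_singleton]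
    omega

theorem norm_map_equiv [DecidableEq X] (p : Equiv.Perm X) (g : FreeGroup X) :
    (FreeGroup.map p g).norm = g.norm := by
  have key (q : Equiv.Perm X) (g : FreeGroup X) : (FreeGroup.map q g).norm ≤ g.norm := by
    rw [map_eq_lift]
    exact norm_lift_le _ (fun x => by simp) g
  refine le_antisymm (key p g) ?_
  have := key p⁻¹ (FreeGroup.map p g)
  rwa [map.comp, ← Equiv.Perm.coe_mul, inv_mul_cancel, Equiv.Perm.coe_one, map.id] at this

theorem map_perm_mul (p q : Equiv.Perm X) (g : FreeGroup X) :
    FreeGroup.map ⇑(p * q) g = FreeGroup.map p (FreeGroup.map q g) := by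
  rw [map.comp, Equiv.Perm.coe_mul]

/-- The left component of the `n`-th power of `(k, p)` in the semidirect product of a free group
with the permutations of its basis. -/
def twistedPow (p : Equiv.Perm X) (k : FreeGroup X) : ℕ → FreeGroup X
  | 0 => 1
  | n + 1 => k * FreeGroup.map p (twistedPow p k n)

theorem twistedPow_comm {p q : Equiv.Perm X} (hpq : Commute p q) {k l : FreeGroup X}
    (h : k * FreeGroup.map p l = l * FreeGroup.map q k) (n : ℕ) :
    twistedPow p k n * FreeGroup.map ⇑(p ^ n) l = l * FreeGroup.map q (twistedPow p k n) := by
  induction n with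
  | zero => simp [twistedPow]
  | succ n ih =>
    rw [pow_succ', map_perm_mul, twistedPow, mul_assoc, ← _root_.map_mul, ih, _root_.map_mul,
      ← mul_assoc, h, mul_assoc, ← map_perm_mul, hpq.eq, map_perm_mul, ← _root_.map_mul]

theorem le_norm_twistedPow [DecidableEq X] {p : Equiv.Perm X} (hp : ∀ x, p x ≠ x)
    {k : FreeGroup X} (hmin : ∀ f, k.norm ≤ (f⁻¹ * k * FreeGroup.map p f).norm) (n : ℕ) :
    n * k.norm ≤ (twistedPow p k n).norm := by
  have junction : ∀ a ∈ k.toWord.getLast?, ∀ b ∈ k.toWord.head?, a.1 = p b.1 → a.2 = b.2 := by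
    intro a ha b hb hab
    by_contra hne
    have hm := hmin (mk [b])
    rcases hL : k.toWord with _ | ⟨b', M⟩
    · simp [hL] at ha
    simp only [hL, List.head?_cons, Option.mem_def, Option.some.injEq] at hb
    subst hb
    rcases List.eq_nil_or_concat M with rfl | ⟨M', a', rfl⟩
    · simp only [hL, List.getLast?_singleton, Option.mem_def, Option.some.injEq] at ha
      subst ha
      exact hp _ hab.symm
    · simp only [hL, List.concat_eq_append, ← List.cons_append, List.getLast?_append,
        List.getLast?_singleton, Option.mem_def, Option.some_or, Option.some.injEq] at ha
      subst ha
      have h1 : FreeGroup.map p (mk [b']) = (mk [a'])⁻¹ := by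
        rw [map.mk, inv_mk]
        simp only [List.map_cons, List.map_nil, invRev, List.reverse_cons, List.reverse_nil,
          List.nil_append, hab]
        congr 3
        revert hne
        cases a'.2 <;> cases b'.2 <;> simp
      have h2 : (mk [b'])⁻¹ * k * FreeGroup.map p (mk [b']) = mk M' := by
        have h5 : k = mk [b'] * mk M' * mk [a'] := by
          rw [← mk_toWord (x := k), hL, mul_mk, mul_mk]
          simp
        rw [h1, h5]
        group
      rw [h2] at hm
      have h3 := norm_mk_le (L₁ := M')
      have h4 : k.norm = M'.length + 2 := by simp [norm, hL]
      omega
  suffices h : ∀ n, ∃ W : List (X × Bool), IsReduced W ∧ mk W = twistedPow p k n ∧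
      W.length = n * k.norm ∧ ∀ b ∈ W.head?, b ∈ k.toWord.head? by
    obtain ⟨W, hW, h1, h2, -⟩ := h n
    rw [← h1, ← h2]
    change _ ≤ (mk W).toWord.length
    rw [toWord_mk, hW.reduce_eq]
  intro n
  induction n with
  | zero => exact ⟨[], by simp [IsReduced.nil, twistedPow, one_eq_mk]⟩
  | succ n ih =>
    obtain ⟨W, hW, h1, h2, h3⟩ := ih
    refine ⟨k.toWord ++ W.map fun x => (p x.1, x.2), ?_, ?_, ?_, ?_⟩
    · refine List.isChain_append.2 ⟨isReduced_toWord, ?_, ?_⟩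
      · rw [List.isChain_map]
        exact hW.imp fun a b hab h => hab (p.injective h)
      · intro a ha b hb
        rw [List.head?_map] at hb
        obtain ⟨b', hb', rfl⟩ := Option.mem_map.1 hb
        exact junction a ha b' (h3 b' hb')
    · rw [← mul_mk, mk_toWord, twistedPow, ← h1, map.mk]
    · simp only [List.length_append, List.length_map, h2, norm]
      ring
    · intro b hb
      rcases hL : k.toWord with _ | ⟨c, M⟩
      · have : W = [] := by
          rw [← List.length_eq_zero_iff, h2]; simp [norm, hL]
        simp [hL, this] at hb
      · simpa [hL] using hb

open Classical in
/-- The endomorphism killing the free generators outside `S`. -/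
def killCompl (S : Set X) : FreeGroup X →* FreeGroup X :=
  FreeGroup.lift fun x => if x ∈ S then of x else 1

theorem lift_eq_of_forall_mem {H : Type*} [Group H] [DecidableEq X] {f f' : X → H}
    {g : FreeGroup X} (h : ∀ a ∈ g.toWord, f a.1 = f' a.1) :
    FreeGroup.lift f g = FreeGroup.lift f' g := by
  rw [← mk_toWord (x := g), lift_mk, lift_mk]
  congr 1
  refine List.map_congr_left fun a ha => ?_
  rw [h a ha]

theorem killCompl_map_eq_one [DecidableEq X] {S : Set X} {p : Equiv.Perm X} {g : FreeGroup X}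
    (h : ∀ a ∈ g.toWord, p a.1 ∉ S) : killCompl S (FreeGroup.map p g) = 1 := by
  have h1 : (killCompl S).comp (FreeGroup.map p) =
      FreeGroup.lift (fun x => killCompl S (of (p x))) := by
    ext; simp
  have h2 := DFunLike.congr_fun h1 g
  rw [MonoidHom.comp_apply] at h2
  rw [h2, lift_eq_of_forall_mem (f' := fun _ => 1)]
  · have : FreeGroup.lift (fun _ : X => (1 : FreeGroup X)) = 1 := by ext; simp
    rw [this, MonoidHom.one_apply]
  · intro a ha
    simp [killCompl, h a ha]

theorem killCompl_map_eq_self [DecidableEq X] {S : Set X} {p : Equiv.Perm X} {g : FreeGroup X}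
    (h : ∀ a ∈ g.toWord, p a.1 ∈ S) :
    killCompl S (FreeGroup.map p g) = FreeGroup.map p g := by
  have h1 : (killCompl S).comp (FreeGroup.map p) =
      FreeGroup.lift (fun x => killCompl S (of (p x))) := by
    ext; simp
  have h2 := DFunLike.congr_fun h1 g
  rw [MonoidHom.comp_apply] at h2
  rw [h2, map_eq_lift]
  refine lift_eq_of_forall_mem fun a ha => ?_
  simp [killCompl, h a ha]

theorem killCompl_twistedPow_eq_one [DecidableEq X] {S : Set X} {p q : Equiv.Perm X}
    {k : FreeGroup X} (h : ∀ a ∈ k.toWord, ∀ i : ℕ, q ((p ^ i) a.1) ∉ S) (n : ℕ) :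
    killCompl S (FreeGroup.map q (twistedPow p k n)) = 1 := by
  induction n generalizing q with
  | zero => simp [twistedPow]
  | succ n ih =>
    rw [twistedPow, _root_.map_mul, _root_.map_mul, ← map_perm_mul,
      killCompl_map_eq_one (fun a ha => h a ha 0), one_mul]
    exact ih fun a ha i => by simpa [pow_succ'] using h a ha (i + 1)

theorem killCompl_twistedPow_eq_self [DecidableEq X] {S : Set X} {p q : Equiv.Perm X}
    {k : FreeGroup X} (h : ∀ a ∈ k.toWord, ∀ i : ℕ, q ((p ^ i) a.1) ∈ S) (n : ℕ) :
    killCompl S (FreeGroup.map q (twistedPow p k n)) = FreeGroup.map q (twistedPow p k n) := by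
  induction n generalizing q with
  | zero => simp [twistedPow]
  | succ n ih =>
    rw [twistedPow, _root_.map_mul, _root_.map_mul, ← map_perm_mul,
      killCompl_map_eq_self (fun a ha => h a ha 0)]
    congr 1
    exact ih fun a ha i => by simpa [pow_succ'] using h a ha (i + 1)

/-- A commuting pair in the semidirect product of a free group with permutations of its basis,
lying over a free abelian group of rank two acting freely on the basis, is conjugate into the
complement. -/
theorem exists_eq_mul_map_inv {p q : Equiv.Perm X} (hpq : Commute p q)
    (hfree : ∀ (i j : ℤ) (x : X), (p ^ i) x = (q ^ j) x → i = 0 ∧ j = 0) {k l : FreeGroup X}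
    (h : k * FreeGroup.map p l = l * FreeGroup.map q k) :
    ∃ f, k = f * (FreeGroup.map p f)⁻¹ := by
  classical
  obtain ⟨f, hf⟩ : ∃ f, ∀ f',
      (f⁻¹ * k * FreeGroup.map p f).norm ≤ (f'⁻¹ * k * FreeGroup.map p f').norm :=
    ⟨_, fun f' => Function.argmin_le (fun f => (f⁻¹ * k * FreeGroup.map p f).norm) f'⟩
  set k' := f⁻¹ * k * FreeGroup.map p f with hk'
  set l' := f⁻¹ * l * FreeGroup.map q f with hl'
  have h' : k' * FreeGroup.map p l' = l' * FreeGroup.map q k' := by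
    simp only [hk', hl', _root_.map_mul, _root_.map_inv]
    rw [← map_perm_mul, ← map_perm_mul, hpq.eq]
    simp only [mul_assoc, mul_inv_cancel_left]
    rw [← mul_assoc k, h, mul_assoc]
  have hp : ∀ x, p x ≠ x := fun x hx => by
    have := hfree 1 0 x (by simpa using hx)
    simp at this
  have hmin : ∀ g, k'.norm ≤ (g⁻¹ * k' * FreeGroup.map p g).norm := fun g => by
    convert hf (f * g) using 2
    simp only [hk', _root_.map_mul, mul_inv_rev, mul_assoc]
  suffices hk1 : k' = 1 by
    refine ⟨f, ?_⟩
    rw [eq_mul_inv_iff_mul_eq, eq_comm, ← inv_mul_eq_one, ← mul_assoc]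
    exact hk1
  by_contra hne
  have hinj (x y : X) (m m' : ℕ) (i i' : ℤ) (h1 : (q ^ m) x = (p ^ i) y)
      (h2 : (q ^ m') x = (p ^ i') y) : m = m' := by
    have e1 : (p ^ (i' - i)) x = (q ^ ((m' : ℤ) - m)) x := by
      have c1 : (p ^ (-i)) ((q ^ (m : ℤ)) x) = y := by simp [h1]
      have c2 : (p ^ (-i')) ((q ^ (m' : ℤ)) x) = y := by simp [h2]
      have c3 := congrArg (⇑(p ^ i' * q ^ (-(m : ℤ)))) (c1.trans c2.symm)
      simp only [← Equiv.Perm.mul_apply] at c3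
      have comm (a b : ℤ) : p ^ a * q ^ b = q ^ b * p ^ a := (hpq.zpow_zpow a b).eq
      rw [show p ^ i' * q ^ (-(m : ℤ)) * (p ^ (-i) * q ^ (m : ℤ)) = p ^ (i' - i) by
          rw [comm (-i), ← mul_assoc, mul_assoc (p ^ i')]
          simp [zpow_sub],
        show p ^ i' * q ^ (-(m : ℤ)) * (p ^ (-i') * q ^ (m' : ℤ)) = q ^ ((m' : ℤ) - m) by
          rw [comm, mul_assoc, ← mul_assoc (p ^ i'), ← zpow_add p,
            add_neg_cancel, zpow_zero, one_mul, ← zpow_add, neg_add_eq_sub]] at c3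
      exact c3
    have := (hfree _ _ x e1).2
    omega
  obtain ⟨m, hm⟩ : ∃ m : ℕ, ∀ a ∈ k'.toWord, ∀ b ∈ k'.toWord, ∀ i : ℤ,
      (q ^ m) a.1 ≠ (p ^ i) b.1 := by
    have hfin : (⋃ a ∈ {a | a ∈ k'.toWord}, ⋃ b ∈ {b | b ∈ k'.toWord},
        {m : ℕ | ∃ i : ℤ, (q ^ m) a.1 = (p ^ i) b.1}).Finite := by
      refine Set.Finite.biUnion (List.finite_toSet _) fun a _ =>
        Set.Finite.biUnion (List.finite_toSet _) fun b _ => Set.Subsingleton.finite ?_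
      rintro m ⟨i, hi⟩ m' ⟨i', hi'⟩
      exact hinj _ _ _ _ _ _ hi hi'
    obtain ⟨m, hm⟩ := hfin.exists_notMem
    refine ⟨m, fun a ha b hb i hi => hm ?_⟩
    simp only [Set.mem_iUnion]
    exact ⟨a, ha, b, hb, i, hi⟩
  have rel := twistedPow_comm (hpq.pow_right m) (twistedPow_comm hpq.symm h'.symm m).symm
    (2 * (twistedPow q l' m).norm + 1)
  set L := twistedPow q l' m
  set K := twistedPow p k' (2 * L.norm + 1) with hK
  let Y : Set X := {y | ∃ a ∈ k'.toWord, ∃ i : ℤ, y = (q ^ m) ((p ^ i) a.1)}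
  have kill : killCompl Y K = 1 := by
    have := killCompl_twistedPow_eq_one (S := Y) (p := p) (q := 1) (k := k') (fun a ha i => ?_)
      (2 * L.norm + 1)
    · simpa using this
    · rintro ⟨b, hb, j, hj⟩
      refine hm b hb a ha (i - j) ?_
      have comm : (q ^ m) ((p ^ j) b.1) = (p ^ j) ((q ^ m) b.1) := by
        rw [← Equiv.Perm.mul_apply, ← ((hpq.pow_right m).zpow_left j).eq, Equiv.Perm.mul_apply]
      rw [Equiv.Perm.one_apply, comm] at hj
      rw [← (p ^ j).injective.eq_iff, ← hj, ← Equiv.Perm.mul_apply, ← zpow_add]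
      simp
  have keep : killCompl Y (FreeGroup.map ⇑(q ^ m) K) = FreeGroup.map ⇑(q ^ m) K :=
    killCompl_twistedPow_eq_self (k := k') (S := Y)
      (fun a ha i => ⟨a, ha, i, by rw [zpow_natCast]⟩) _
  have knorm (g : FreeGroup X) : (killCompl Y g).norm ≤ g.norm :=
    norm_lift_le _ (fun x => by split_ifs <;> simp) g
  have rel2 := congrArg (killCompl Y) rel
  rw [_root_.map_mul, _root_.map_mul, kill, keep, one_mul, ← inv_mul_eq_iff_eq_mul] at rel2
  have n1 := norm_mul_le (killCompl Y L)⁻¹ (killCompl Y (FreeGroup.map ⇑(p ^ (2 * L.norm + 1)) L))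
  rw [rel2, norm_map_equiv, norm_inv_eq] at n1
  have n2 := knorm L
  have n3 := knorm (FreeGroup.map ⇑(p ^ (2 * L.norm + 1)) L)
  rw [norm_map_equiv] at n3
  have n4 := le_norm_twistedPow hp hmin (2 * L.norm + 1)
  have n5 : 1 ≤ k'.norm := Nat.one_le_iff_ne_zero.2 fun h0 => hne (norm_eq_zero.1 h0)
  nlinarith

end FreeGroup

namespace FreeGroup

variable {X : Type*}

theorem toWord_map_perm [DecidableEq X] (p : Equiv.Perm X) (f : FreeGroup X) :
    (FreeGroup.map p f).toWord = f.toWord.map fun a => (p a.1, a.2) := by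
  have h1 : FreeGroup.map p f = mk (f.toWord.map fun a => (p a.1, a.2)) := by
    conv_lhs => rw [← mk_toWord (x := f), map.mk]
  have h2 : IsReduced (f.toWord.map fun a => (p a.1, a.2)) := by
    unfold IsReduced
    rw [List.isChain_map]
    exact (isReduced_toWord (x := f)).imp fun a b hab h => hab (p.injective h)
  rw [h1, toWord_mk, h2.reduce_eq]

/-- A permutation of the basis without finite orbits fixes no nontrivial element. -/
theorem eq_one_of_map_eq {p : Equiv.Perm X} (hp : ∀ (i : ℤ) (x : X), (p ^ i) x = x → i = 0)
    {f : FreeGroup X} (h : FreeGroup.map p f = f) : f = 1 := by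
  classical
  rw [← toWord_eq_nil_iff]
  by_contra hne
  obtain ⟨a, ha⟩ := List.exists_mem_of_ne_nil _ hne
  have h1 : ∀ n : ℕ, ∃ b ∈ f.toWord, b.1 = (p ^ n) a.1 := by
    intro n
    induction n with
    | zero => exact ⟨a, ha, rfl⟩
    | succ n ih =>
      obtain ⟨b, hb, hab⟩ := ih
      refine ⟨(p b.1, b.2), ?_, ?_⟩
      · rw [← h, toWord_map_perm]
        exact List.mem_map.2 ⟨b, hb, rfl⟩
      · rw [pow_succ', Equiv.Perm.mul_apply, ← hab]
  have hinj : Function.Injective fun n : ℕ => (p ^ n) a.1 := by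
    intro m n hmn
    have h3 : (p ^ ((n : ℤ) - m)) a.1 = a.1 := by
      have := congrArg (⇑(p ^ (-(m : ℤ)))) hmn
      simp only [← Equiv.Perm.mul_apply, ← zpow_natCast, ← zpow_add, neg_add_cancel, zpow_zero,
        Equiv.Perm.one_apply, neg_add_eq_sub] at this
      exact this.symm
    have := hp _ _ h3
    omega
  refine Set.infinite_range_of_injective hinj
    ((List.finite_toSet (f.toWord.map Prod.fst)).subset ?_)
  rintro _ ⟨n, rfl⟩
  obtain ⟨b, hb, hab⟩ := h1 n
  exact List.mem_map.2 ⟨b, hb, hab⟩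

/-- Permutations of a basis act on the free group. -/
def permAut (X : Type*) : Equiv.Perm X →* MulAut (FreeGroup X) where
  toFun p := freeGroupCongr p
  map_one' := by ext; simp
  map_mul' p q := by
    ext g
    exact map_perm_mul p q g

end FreeGroup

namespace RAAG

variable {V : Type} {G : SimpleGraph V} {v : V}

/-- The index set of the free kernel of the retraction killing `v`. -/
abbrev Cosets (G : SimpleGraph V) (v : V) := RAAG G ⧸ par G (G.neighborSet v)

/-- The action of a right-angled Artin group on the free group on the cosets of a link. -/
def act (G : SimpleGraph V) (v : V) : RAAG G →* MulAut (FreeGroup (Cosets G v)) :=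
  (FreeGroup.permAut _).comp (MulAction.toPermHom (RAAG G) (Cosets G v))

theorem act_apply (g : RAAG G) (f : FreeGroup (Cosets G v)) :
    act G v g f = FreeGroup.map (MulAction.toPermHom (RAAG G) (Cosets G v) g) f := rfl

open Classical in
/-- The embedding of the group into a semidirect product that exhibits the kernel of the
retraction killing `v` as a free group. -/
def split (G : SimpleGraph V) (v : V) :
    RAAG G →* FreeGroup (Cosets G v) ⋊[act G v] RAAG G :=
  lift (fun w => if w = v then .inl (.of (QuotientGroup.mk 1)) else .inr (gen G w)) (by
    have key : ∀ w, G.Adj v w →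
        Commute (SemidirectProduct.inl (FreeGroup.of (QuotientGroup.mk 1)) :
          FreeGroup (Cosets G v) ⋊[act G v] RAAG G) (.inr (gen G w)) := by
      intro w hw
      have h1 : act G v (gen G w) (.of (QuotientGroup.mk 1)) = .of (QuotientGroup.mk 1) := by
        rw [act_apply, FreeGroup.map.of]
        congr 1
        change ((gen G w * 1 : RAAG G) : Cosets G v) = _
        rw [eq_comm, QuotientGroup.eq]
        simp only [inv_one, one_mul, mul_one]
        exact gen_mem_par hw
      ext
      · simp [h1]
      · simp
    intro u w h
    split_ifs with hu hw hw
    · rfl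
    · subst hu; exact key w h
    · subst hw; exact (key u h.symm).symm
    · exact (commute_gen h).map _)

/-- The left inverse of `split`. -/
def unsplit (G : SimpleGraph V) (v : V) :
    FreeGroup (Cosets G v) ⋊[act G v] RAAG G →* RAAG G :=
  SemidirectProduct.lift
    (FreeGroup.lift (Quotient.lift (fun a => a * gen G v * a⁻¹) (by
      intro a b hab
      have h1 : a⁻¹ * b ∈ par G (G.neighborSet v) := QuotientGroup.leftRel_apply.1 hab
      have h2 : par G (G.neighborSet v) ≤ Subgroup.centralizer {gen G v} := par_le fun w hw => by
        rw [Subgroup.mem_centralizer_singleton_iff]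
        exact (commute_gen hw).eq.symm
      have h3 := Subgroup.mem_centralizer_singleton_iff.1 (h2 h1)
      have h4 : b = a * (a⁻¹ * b) := by group
      rw [h4]
      generalize a⁻¹ * b = t at h3
      change a * gen G v * a⁻¹ = a * t * gen G v * (a * t)⁻¹
      rw [mul_assoc a t, h3]
      group)))
    (MonoidHom.id _) (by
      intro g
      ext x
      induction x using QuotientGroup.induction_on with
      | H a =>
        simp only [MonoidHom.comp_apply, MulEquiv.coe_toMonoidHom, act_apply, FreeGroup.map.of,
          FreeGroup.lift_apply_of, MonoidHom.id_apply, MulAut.conj_apply]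
        change (g * a) * gen G v * (g * a)⁻¹ = g * (a * gen G v * a⁻¹) * g⁻¹
        group)

@[simp]
theorem unsplit_inr (g : RAAG G) : unsplit G v (.inr g) = g := by
  simp [unsplit]

@[simp]
theorem unsplit_split (g : RAAG G) : unsplit G v (split G v g) = g := by
  have : (unsplit G v).comp (split G v) = MonoidHom.id _ := by
    refine hom_ext fun w => ?_
    by_cases hw : w = v
    · subst hw
      simp only [MonoidHom.comp_apply, split, lift_gen, if_pos, unsplit,
        SemidirectProduct.lift_inl, FreeGroup.lift_apply_of, MonoidHom.id_apply]
      change 1 * gen G w * 1⁻¹ = _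
      simp
    · simp [split, hw]
  exact DFunLike.congr_fun this g

theorem split_right (g : RAAG G) : (split G v g).right = ret {v}ᶜ g := by
  have : SemidirectProduct.rightHom.comp (split G v) = ret {v}ᶜ := by
    refine hom_ext fun w => ?_
    by_cases hw : w = v
    · subst hw
      rw [ret_gen_notMem (by simp)]
      simp [split]
    · rw [ret_gen_mem (by simpa using hw)]
      simp [split, hw]
  exact DFunLike.congr_fun this g

theorem split_of_mem {s : RAAG G} (hs : s ∈ par G {v}ᶜ) : split G v s = .inr s := by
  refine eqOn_par (g := SemidirectProduct.inr) (fun w hw => ?_) hs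
  have : w ≠ v := hw
  simp [split, this]

theorem expo_eq_of_smul_eq {z : V} (hz : ¬G.Adj v z) {a b : RAAG G} {x : Cosets G v}
    (h : a • x = b • x) : expo z a = expo z b := by
  induction x using QuotientGroup.induction_on with
  | H g =>
    have h1 : (a * g)⁻¹ * (b * g) ∈ par G (G.neighborSet v) := QuotientGroup.eq.1 h
    have h2 := expo_eq_zero_of_mem_par hz h1
    simp at h2
    omega

/-- An element conjugating a suitable element of the standard subgroup omitting `v` into that
subgroup lies in the subgroup. -/
theorem mem_par_compl_of_conj {z : V} (hz : ¬G.Adj v z) {s g : RAAG G}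
    (hs : s ∈ par G {v}ᶜ) (hg : g⁻¹ * s * g ∈ par G {v}ᶜ) (hsz : expo z s ≠ 0) :
    g ∈ par G {v}ᶜ := by
  set p := ret {v}ᶜ g with hp
  have h1 : g⁻¹ * s * g = p⁻¹ * s * p := by
    rw [← ret_eq_self hg]
    simp [ret_eq_self hs, hp]
  have h2 : s * (g * p⁻¹) = g * p⁻¹ * s := by
    have : s * (g * p⁻¹) = g * (g⁻¹ * s * g) * p⁻¹ := by group
    rw [this, h1]
    group
  have h3 : (split G v (g * p⁻¹)).right = 1 := by
    rw [split_right, map_mul, map_inv, ret_eq_self (ret_mem_par _ _), mul_inv_cancel]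
  have h4 := congrArg (fun x => (split G v x).left) h2
  simp only [map_mul _ s, map_mul _ (g * p⁻¹), split_of_mem hs, SemidirectProduct.mul_left,
    SemidirectProduct.left_inr, SemidirectProduct.right_inr, h3, map_one, one_mul, mul_one,
    act_apply] at h4
  have h5 := FreeGroup.eq_one_of_map_eq (fun i x hix => by
    rw [← map_zpow] at hix
    have := expo_eq_of_smul_eq hz (b := 1) (hix.trans (one_smul _ x).symm)
    simpa [hsz] using this) h4
  have h6 : split G v (g * p⁻¹) = 1 := SemidirectProduct.ext h5 h3
  have h7 := congrArg (unsplit G v) h6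
  rw [unsplit_split, map_one, mul_inv_eq_one] at h7
  rw [h7]
  exact ret_mem_par _ _

/-- Two commuting elements that look homologically like distinct generators outside the star of
`v` are simultaneously conjugate into the standard subgroup omitting `v`. -/
theorem exists_conj_mem_par_compl {w z : V} (hwv : w ≠ v) (hw : ¬G.Adj v w) (hzv : z ≠ v)
    (hz : ¬G.Adj v z) {a b : RAAG G} (hab : Commute a b) (haw : expo w a = 1)
    (haz : expo z a = 0) (hbw : expo w b = 0) (hbz : expo z b = 1) :
    ∃ g : RAAG G, g⁻¹ * a * g ∈ par G {v}ᶜ ∧ g⁻¹ * b * g ∈ par G {v}ᶜ := by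
  have hα := split_right (v := v) a
  have hβ := split_right (v := v) b
  set α := ret {v}ᶜ a with hα'
  set β := ret {v}ᶜ b with hβ'
  have hcomm : Commute α β := hab.map _
  have hrel := congrArg (fun x => (split G v x).left) hab.eq
  simp only [map_mul, SemidirectProduct.mul_left, hα, hβ, act_apply] at hrel
  have ew : ∀ (i j : ℤ) (x : Cosets G v), α ^ i • x = β ^ j • x → i = 0 ∧ j = 0 := by
    intro i j x h
    have h1 := expo_eq_of_smul_eq hw h
    have h2 := expo_eq_of_smul_eq hz h
    rw [expo_zpow, expo_zpow, hα', hβ', expo_ret (by simpa), expo_ret (by simpa)] at h1 h2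
    rw [haw, hbw] at h1
    rw [haz, hbz] at h2
    simp at h1 h2
    exact ⟨h1, h2.symm⟩
  obtain ⟨f, hf⟩ := FreeGroup.exists_eq_mul_map_inv (hcomm.map (MulAction.toPermHom _ _))
    (fun i j x h => by
      refine ew i j x ?_
      change MulAction.toPermHom (RAAG G) (Cosets G v) (α ^ i) x =
        MulAction.toPermHom (RAAG G) (Cosets G v) (β ^ j) x
      rw [map_zpow, map_zpow]
      exact h) hrel
  have h1 : split G v a = .inl f * .inr α * (.inl f)⁻¹ := by
    ext
    · simp [hf, act_apply]
    · simp [hα]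
  set g := unsplit G v (.inl f)
  have h2 : a = g * α * g⁻¹ := by
    rw [← unsplit_split (v := v) a, h1]
    simp [g]
  have h3 : g⁻¹ * a * g = α := by rw [h2]; group
  have hαm : α ∈ par G {v}ᶜ := ret_mem_par _ _
  refine ⟨g, h3 ▸ hαm, mem_par_compl_of_conj hw hαm (g := g⁻¹ * b * g) ?_ ?_⟩
  · have : (g⁻¹ * b * g)⁻¹ * α * (g⁻¹ * b * g) = α := by
      rw [mul_assoc, inv_mul_eq_iff_eq_mul, ← h3]
      have := hab.eq
      calc g⁻¹ * a * g * (g⁻¹ * b * g) = g⁻¹ * (a * b) * g := by group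
        _ = _ := by rw [this]; group
    rwa [this]
  · rw [hα', expo_ret (by simpa), haw]
    exact one_ne_zero

end RAAG

/-- The integral Heisenberg group. -/
@[ext]
structure Heis where
  a : ℤ
  b : ℤ
  c : ℤ

namespace Heis

instance : Mul Heis := ⟨fun x y => ⟨x.a + y.a, x.b + y.b, x.c + y.c + x.a * y.b⟩⟩
instance : One Heis := ⟨⟨0, 0, 0⟩⟩
instance : Inv Heis := ⟨fun x => ⟨-x.a, -x.b, -x.c + x.a * x.b⟩⟩

@[simp] theorem mul_a (x y : Heis) : (x * y).a = x.a + y.a := rfl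
@[simp] theorem mul_b (x y : Heis) : (x * y).b = x.b + y.b := rfl
@[simp] theorem mul_c (x y : Heis) : (x * y).c = x.c + y.c + x.a * y.b := rfl
@[simp] theorem one_a : (1 : Heis).a = 0 := rfl
@[simp] theorem one_b : (1 : Heis).b = 0 := rfl
@[simp] theorem one_c : (1 : Heis).c = 0 := rfl
@[simp] theorem inv_a (x : Heis) : x⁻¹.a = -x.a := rfl
@[simp] theorem inv_b (x : Heis) : x⁻¹.b = -x.b := rfl
@[simp] theorem inv_c (x : Heis) : x⁻¹.c = -x.c + x.a * x.b := rfl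

instance : Group Heis :=
  Group.ofLeftAxioms (fun x y z => by ext <;> simp <;> ring) (fun x => by ext <;> simp)
    (fun x => by ext <;> simp)

/-- The first coordinate as a homomorphism. -/
def aHom : Heis →* Multiplicative ℤ where
  toFun x := .ofAdd x.a
  map_one' := rfl
  map_mul' _ _ := rfl

/-- The second coordinate as a homomorphism. -/
def bHom : Heis →* Multiplicative ℤ where
  toFun x := .ofAdd x.b
  map_one' := rfl
  map_mul' _ _ := rfl

end Heis

namespace RAAG

variable {V : Type} {G : SimpleGraph V} {c : V}

open Classical in
/-- Commuting elements have proportional exponent sums on nonadjacent vertices. -/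
theorem expo_mul_expo_comm {s t : V} (hst : s ≠ t) (hadj : ¬G.Adj s t) {x y : RAAG G}
    (h : Commute x y) : expo s x * expo t y = expo t x * expo s y := by
  let η : RAAG G →* Heis :=
    lift (fun v => if v = s then ⟨1, 0, 0⟩ else if v = t then ⟨0, 1, 0⟩ else 1) (by
      intro u w huw
      split_ifs <;> simp_all [SimpleGraph.adj_comm])
  have ha (z : RAAG G) : (η z).a = expo s z := by
    have : Heis.aHom.comp η = expHom s := hom_ext fun v => by
      by_cases h1 : v = s
      · simp [η, h1, Heis.aHom, expHom]
      · by_cases h2 : v = t <;> simp [η, h1, h2, Heis.aHom, expHom, Ne.symm hst]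
    exact congrArg Multiplicative.toAdd (DFunLike.congr_fun this z)
  have hb (z : RAAG G) : (η z).b = expo t z := by
    have : Heis.bHom.comp η = expHom t := hom_ext fun v => by
      by_cases h1 : v = s
      · simp [η, h1, Heis.bHom, expHom, hst]
      · by_cases h2 : v = t <;> simp [η, h1, h2, Heis.bHom, expHom, Ne.symm hst]
    exact congrArg Multiplicative.toAdd (DFunLike.congr_fun this z)
  have h1 := congrArg Heis.c (h.map η).eq
  simp only [Heis.mul_c, ha, hb] at h1
  linarith

theorem commute_apply_of_mem_star (φ : MulAut (RAAG G)) {v y : V} (hy : y ∈ _root_.star G v) :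
    Commute (φ (gen G y)) (φ (gen G v)) := by
  rcases hy with rfl | h
  · rfl
  · exact ((commute_gen h).map φ).symm

/-- The matrix of the action on the abelianization. -/
def linMat (φ : MulAut (RAAG G)) : Matrix V V ℤ := Matrix.of fun v w => expo w (φ (gen G v))

theorem linMat_apply (φ : MulAut (RAAG G)) (v w : V) : linMat φ v w = expo w (φ (gen G v)) := rfl

open Classical in
theorem linMat_one : linMat (1 : MulAut (RAAG G)) = 1 := by
  ext v w
  simp [linMat_apply, Matrix.one_apply, expo_gen]

theorem linMat_mul_comm (φ : MulAut (RAAG G)) {v y s t : V} (hy : y ∈ _root_.star G v)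
    (ht : t ∉ _root_.star G s) :
    linMat φ y t * linMat φ v s = linMat φ y s * linMat φ v t := by
  rw [mem_star, not_or] at ht
  exact expo_mul_expo_comm ht.1 (fun h => ht.2 h.symm) (commute_apply_of_mem_star φ hy)

theorem perm_eq_one_of_adj [Finite V] (hT : TrivialAut G) (τ : Equiv.Perm V)
    (h : ∀ u v, G.Adj u v → G.Adj (τ u) (τ v)) : τ = 1 := by
  have hpow (n : ℕ) : ∀ u v, G.Adj u v → G.Adj ((τ ^ n) u) ((τ ^ n) v) := by
    induction n with
    | zero => simp
    | succ n ih =>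
      intro u v huv
      simpa [pow_succ'] using h _ _ (ih u v huv)
  have hinv : ∀ u v, G.Adj u v → G.Adj (τ⁻¹ u) (τ⁻¹ v) := by
    have : τ⁻¹ = τ ^ (orderOf τ - 1) := by
      rw [inv_eq_iff_mul_eq_one, ← pow_succ', Nat.sub_add_cancel (orderOf_pos τ),
        pow_orderOf_eq_one]
    rw [this]
    exact hpow _
  let e : G ≃g G := ⟨τ, fun {a b} => ⟨fun hab => by simpa using hinv _ _ hab, h a b⟩⟩
  ext v
  exact hT e v

variable [Fintype V]

theorem linMat_mul (φ ψ : MulAut (RAAG G)) : linMat (φ * ψ) = linMat ψ * linMat φ := by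
  ext v w
  rw [Matrix.mul_apply, linMat_apply, MulAut.mul_apply]
  exact expo_hom φ.toMonoidHom w _

open Classical in
theorem exists_perm_linMat_ne_zero (φ : MulAut (RAAG G)) :
    ∃ τ : Equiv.Perm V, ∀ v, linMat φ v (τ v) ≠ 0 := by
  have h1 : (linMat φ).det ≠ 0 := by
    have : (linMat φ).det * (linMat φ⁻¹).det = 1 := by
      rw [← Matrix.det_mul, ← linMat_mul, inv_mul_cancel, linMat_one, Matrix.det_one]
    exact left_ne_zero_of_mul_eq_one this
  rw [Matrix.det_apply] at h1
  obtain ⟨σ, -, hσ⟩ := Finset.exists_ne_zero_of_sum_ne_zero h1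
  refine ⟨σ⁻¹, fun v hv => hσ ?_⟩
  rw [Finset.prod_eq_zero (i := σ⁻¹ v) (Finset.mem_univ _) (by simpa using hv), smul_zero]

open Classical in
/-- The block of the matrix of an automorphism with rows in one star and columns in another. -/
def starMap (φ : MulAut (RAAG G)) (v u : V) :
    (_root_.star G v → ℚ) →ₗ[ℚ] (_root_.star G u → ℚ) :=
  (((linMat φ).map ((↑) : ℤ → ℚ)).submatrix Subtype.val Subtype.val).vecMulLinear

open Classical in
theorem starMap_apply (φ : MulAut (RAAG G)) (v u : V) (x : _root_.star G v → ℚ)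
    (t : _root_.star G u) :
    starMap φ v u x t = ∑ y, x y * (linMat φ y t : ℚ) := by
  simp [starMap, Matrix.vecMul, dotProduct]

theorem starMap_injective (φ : MulAut (RAAG G)) {v u : V} (hu : linMat φ v u ≠ 0) :
    Function.Injective (starMap φ v u) := by
  classical
  rw [← LinearMap.ker_eq_bot, LinearMap.ker_eq_bot']
  intro x hx
  have h1 (t : V) : ∑ y, x y * (linMat φ y t : ℚ) = 0 := by
    by_cases ht : t ∈ _root_.star G u
    · rw [← starMap_apply φ v u x ⟨t, ht⟩, hx]; rfl
    · have h2 := congrFun hx ⟨u, Or.inl rfl⟩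
      rw [starMap_apply] at h2
      have hu' : (linMat φ v u : ℚ) ≠ 0 := by exact_mod_cast hu
      refine (mul_eq_zero.1 (?_ : _ * (linMat φ v u : ℚ) = 0)).resolve_right hu'
      calc (∑ y, x y * (linMat φ y t : ℚ)) * (linMat φ v u : ℚ)
          = (∑ y, x y * (linMat φ y u : ℚ)) * (linMat φ v t : ℚ) := by
            rw [Finset.sum_mul, Finset.sum_mul]
            refine Finset.sum_congr rfl fun y _ => ?_
            have := linMat_mul_comm φ y.2 ht
            rw [mul_assoc, mul_assoc]
            congr 1
            exact_mod_cast this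
        _ = 0 := by simpa using Or.inl h2
  ext y₀
  have h3 : (linMat φ) * (linMat φ⁻¹) = 1 := by
    rw [← linMat_mul, inv_mul_cancel, linMat_one]
  have h4 (y : V) : ∑ t, (linMat φ y t : ℚ) * (linMat φ⁻¹ t y₀ : ℚ) = if y = y₀ then 1 else 0 := by
    have := congrFun (congrFun h3 y) y₀
    rw [Matrix.mul_apply, Matrix.one_apply] at this
    exact_mod_cast this
  have h5 : ∑ t, (∑ y, x y * (linMat φ y t : ℚ)) * (linMat φ⁻¹ t y₀ : ℚ) = x y₀ := by
    simp_rw [Finset.sum_mul]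
    rw [Finset.sum_comm]
    simp_rw [mul_assoc, ← Finset.mul_sum, h4]
    simp [Subtype.val_inj]
  simpa [h1] using h5.symm

theorem card_star_le (φ : MulAut (RAAG G)) {v u : V} (hu : linMat φ v u ≠ 0) :
    Nat.card (_root_.star G v) ≤ Nat.card (_root_.star G u) := by
  classical
  have := LinearMap.finrank_le_finrank_of_injective (starMap_injective φ hu)
  simpa [Nat.card_eq_fintype_card] using this

theorem dominates_of_card_eq (φ : MulAut (RAAG G)) {v u s : V} (hu : linMat φ v u ≠ 0)
    (hcard : Nat.card (_root_.star G v) = Nat.card (_root_.star G u)) (hs : linMat φ v s ≠ 0) :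
    Dominates G s u := by
  classical
  have hsurj : Function.Surjective (starMap φ v u) := by
    refine (LinearMap.injective_iff_surjective_of_finrank_eq_finrank ?_).1
      (starMap_injective φ hu)
    simpa [Nat.card_eq_fintype_card] using hcard
  intro t ht
  by_contra hts
  have htu : t ∈ _root_.star G u := Or.inr ht
  have htu' : t ≠ u := (G.ne_of_adj ht).symm
  have hts' : t ≠ s := fun h => hts (Or.inl h)
  obtain ⟨x, hx⟩ := hsurj (Pi.single ⟨t, htu⟩ 1)
  have hxt : ∑ y, x y * (linMat φ y t : ℚ) = 1 := by
    rw [← starMap_apply φ v u x ⟨t, htu⟩, hx, Pi.single_eq_same]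
  have hx0 (r : V) (hr : r ∈ _root_.star G u) (hrt : r ≠ t) :
      ∑ y, x y * (linMat φ y r : ℚ) = 0 := by
    rw [← starMap_apply φ v u x ⟨r, hr⟩, hx, Pi.single_eq_of_ne]
    simpa using hrt
  have rel (r r' : V) (hr : r' ∉ _root_.star G r) :
      (∑ y, x y * (linMat φ y r' : ℚ)) * (linMat φ v r : ℚ) =
        (∑ y, x y * (linMat φ y r : ℚ)) * (linMat φ v r' : ℚ) := by
    rw [Finset.sum_mul, Finset.sum_mul]
    refine Finset.sum_congr rfl fun y _ => ?_
    have := linMat_mul_comm φ y.2 hr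
    rw [mul_assoc, mul_assoc]
    congr 1
    exact_mod_cast this
  have hu' : (linMat φ v u : ℚ) ≠ 0 := by exact_mod_cast hu
  have hs' : (linMat φ v s : ℚ) ≠ 0 := by exact_mod_cast hs
  have hs0 : ∑ y, x y * (linMat φ y s : ℚ) = 0 := by
    by_cases hsm : s ∈ _root_.star G u
    · exact hx0 s hsm hts'.symm
    · have := rel u s hsm
      rw [hx0 u (Or.inl rfl) htu'.symm, zero_mul] at this
      exact (mul_eq_zero.1 this).resolve_right hu'
  have := rel s t hts
  rw [hs0, hxt, zero_mul, one_mul] at this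
  exact hs' this

theorem linMat_diag_ne_zero_and_shape (hF : Focused G c) (hT : TrivialAut G)
    (φ : MulAut (RAAG G)) : (∀ v, linMat φ v v ≠ 0) ∧
      ∀ v s, linMat φ v s ≠ 0 → s ≠ v → s = c ∧ Dominates G c v := by
  obtain ⟨τ, hτ⟩ := exists_perm_linMat_ne_zero φ
  have hcard : ∀ v, Nat.card (_root_.star G v) = Nat.card (_root_.star G (τ v)) := by
    have := (Finset.sum_eq_sum_iff_of_le fun v (_ : v ∈ Finset.univ) =>
      card_star_le φ (hτ v)).1 (Equiv.sum_comp τ fun v => Nat.card (_root_.star G v)).symm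
    exact fun v => this v (Finset.mem_univ v)
  have hdom (v s : V) (hs : linMat φ v s ≠ 0) : Dominates G s (τ v) :=
    dominates_of_card_eq φ (hτ v) (hcard v) hs
  have hτ1 : τ = 1 := by
    refine perm_eq_one_of_adj hT τ fun u v huv => ?_
    by_contra hadj
    have hne : τ v ≠ τ u := fun h => G.ne_of_adj huv (τ.injective h).symm
    have h1 := linMat_mul_comm φ (v := u) (y := v) (s := τ u) (t := τ v) (Or.inr huv)
      (fun h => h.elim hne hadj)
    have h2 : linMat φ v (τ u) * linMat φ u (τ v) ≠ 0 := by
      rw [← h1]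
      exact mul_ne_zero (hτ v) (hτ u)
    have h3 := hF.1 _ _ hne.symm (hdom _ _ (left_ne_zero_of_mul h2))
    have h4 := hF.1 _ _ hne (hdom _ _ (right_ne_zero_of_mul h2))
    exact hne (h4.trans h3.symm)
  subst hτ1
  refine ⟨hτ, fun v s hs hne => ?_⟩
  have h1 := hdom v s hs
  have h2 := hF.1 _ _ hne h1
  exact ⟨h2, h2 ▸ h1⟩

theorem linMat_ne_zero_imp (hF : Focused G c) (hT : TrivialAut G) (φ : MulAut (RAAG G))
    {v s : V} (hs : linMat φ v s ≠ 0) (hne : s ≠ v) : s = c ∧ Dominates G c v :=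
  (linMat_diag_ne_zero_and_shape hF hT φ).2 v s hs hne

/-- The homomorphism recording the diagonal of the action on the abelianization. -/
def diagHom (hF : Focused G c) (hT : TrivialAut G) : MulAut (RAAG G) →* (V → ℤ) where
  toFun φ v := linMat φ v v
  map_one' := by
    ext v
    simp [linMat_one]
  map_mul' φ ψ := by
    ext v
    rw [linMat_mul, Matrix.mul_apply, Finset.sum_eq_single v, mul_comm]
    · rfl
    · intro s _ hsv
      by_contra hne
      have h1 := linMat_ne_zero_imp hF hT ψ (left_ne_zero_of_mul hne) hsv
      have h2 := linMat_ne_zero_imp hF hT φ (right_ne_zero_of_mul hne) hsv.symm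
      exact hsv (h1.1.trans h2.1.symm)
    · simp

theorem diagHom_apply (hF : Focused G c) (hT : TrivialAut G) (φ : MulAut (RAAG G)) (v : V) :
    diagHom hF hT φ v = expo v (φ (gen G v)) := rfl

theorem diagHom_eq_one_or_neg_one (hF : Focused G c) (hT : TrivialAut G) (φ : MulAut (RAAG G))
    (v : V) : diagHom hF hT φ v = 1 ∨ diagHom hF hT φ v = -1 := by
  refine Int.isUnit_iff.1 (IsUnit.of_mul_eq_one (diagHom hF hT φ⁻¹ v) ?_)
  rw [← Pi.mul_apply, ← map_mul, mul_inv_cancel, map_one, Pi.one_apply]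

end RAAG

namespace RAAG

variable {V : Type} {G : SimpleGraph V} {c v : V}

/-- The automorphism inverting the generators on which a sign function is `-1`. -/
def signAut (G : SimpleGraph V) : (V → ℤˣ) →* MulAut (RAAG G) :=
  let f (ε : V → ℤˣ) : RAAG G →* RAAG G := lift (fun w => gen G w ^ (ε w : ℤ))
    fun _ _ h => (commute_gen h).zpow_zpow _ _
  have hf (ε δ : V → ℤˣ) (w : V) : f ε (f δ (gen G w)) = gen G w ^ ((ε w * δ w : ℤˣ) : ℤ) := by
    simp [f, zpow_mul]
  have hf1 (ε : V → ℤˣ) (w : V) : f ε (f ε (gen G w)) = gen G w := by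
    rw [hf, Int.units_mul_self, Units.val_one, zpow_one]
  { toFun ε := mkAut (f ε) (f ε) (hf1 ε) (hf1 ε)
    map_one' := aut_ext fun w => by simp [f]
    map_mul' ε δ := aut_ext fun w => by
      rw [MulAut.mul_apply, mkAut_apply, mkAut_apply, mkAut_apply, hf]
      simp [f] }

@[simp]
theorem signAut_gen (ε : V → ℤˣ) (w : V) : signAut G ε (gen G w) = gen G w ^ (ε w : ℤ) :=
  lift_gen (fun w => gen G w ^ (ε w : ℤ)) (fun _ _ h => (commute_gen h).zpow_zpow _ _) w

theorem signAut_injective : Function.Injective (signAut G) := by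
  intro ε δ h
  ext w
  have := congrArg (fun φ => expo w (φ (gen G w))) h
  simpa using this

open Classical in
theorem range_signAut [Fintype V] : (signAut G).range = InvSubgroup G := by
  have key (φ : MulAut (RAAG G)) (v : V) :
      IsInversion G φ v ↔ φ = signAut G (Pi.mulSingle v (-1)) := by
    constructor
    · intro h
      refine aut_ext fun w => ?_
      by_cases hw : w = v
      · subst hw; simp [h.1]
      · simp [h.2 w hw, Pi.mulSingle_eq_of_ne hw]
    · rintro rfl
      refine ⟨by simp, fun w hw => ?_⟩
      simp [Pi.mulSingle_eq_of_ne hw]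
  apply le_antisymm
  · rintro _ ⟨ε, rfl⟩
    rw [← Finset.univ_prod_mulSingle ε]
    refine Subgroup.mem_comap.1 (Subgroup.prod_mem (K := (InvSubgroup G).comap (signAut G))
      fun v _ => ?_)
    rw [Subgroup.mem_comap]
    rcases Int.units_eq_one_or (ε v) with h | h
    · rw [h, Pi.mulSingle_one, map_one]
      exact one_mem _
    · rw [h]
      exact Subgroup.subset_closure ⟨v, (key _ v).2 rfl⟩
  · rw [InvSubgroup, Subgroup.closure_le]
    rintro φ ⟨v, hv⟩
    exact ⟨_, ((key φ v).1 hv).symm⟩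

open Classical in
/-- Powers of a transvection. -/
def transHom (h : Dominates G c v) (n : ℤ) : RAAG G →* RAAG G :=
  lift (fun w => if w = v then gen G c ^ n * gen G w else gen G w) (by
    have key (w : V) (hw : G.Adj v w) : Commute (gen G c ^ n * gen G v) (gen G w) := by
      refine Commute.mul_left (Commute.zpow_left ?_ n) (commute_gen hw)
      rcases h hw with rfl | hcw
      · rfl
      · exact commute_gen hcw
    intro u w huw
    split_ifs with hu hw hw
    · subst hu; subst hw; rfl
    · subst hu; exact key w huw
    · subst hw; exact (key u huw.symm).symm
    · exact commute_gen huw)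

theorem transHom_self (h : Dominates G c v) (n : ℤ) :
    transHom h n (gen G v) = gen G c ^ n * gen G v := by simp [transHom]

theorem transHom_of_ne (h : Dominates G c v) (n : ℤ) {w : V} (hw : w ≠ v) :
    transHom h n (gen G w) = gen G w := by simp [transHom, hw]

theorem transHom_comp (h : Dominates G c v) (hcv : c ≠ v) {m n : ℤ} (hmn : m + n = 0) (w : V) :
    transHom h m (transHom h n (gen G w)) = gen G w := by
  by_cases hw : w = v
  · subst hw
    rw [transHom_self, map_mul, map_zpow, transHom_of_ne h m hcv, transHom_self, ← mul_assoc,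
      ← zpow_add, add_comm n, hmn, zpow_zero, one_mul]
  · rw [transHom_of_ne h n hw, transHom_of_ne h m hw]

theorem exists_isTransvection (h : Dominates G c v) (hcv : c ≠ v) :
    ∃ φ : MulAut (RAAG G), IsTransvection G φ c v :=
  ⟨mkAut (transHom h 1) (transHom h (-1)) (transHom_comp h hcv (by simp))
      (transHom_comp h hcv (by simp)), hcv, h, by simp [transHom_self],
    fun _ hw => by simp [transHom_of_ne h 1 hw]⟩

/-- The exponent vectors of the products of transvections by `c`. -/
def transVectors (G : SimpleGraph V) (c : V) : AddSubgroup (V → ℤ) where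
  carrier := {j | j c = 0 ∧ ∃ φ ∈ PCT G, ∀ w, φ (gen G w) = gen G c ^ j w * gen G w}
  zero_mem' := ⟨rfl, 1, one_mem _, fun w => by simp⟩
  add_mem' := by
    rintro j k ⟨hj, φ, hφ, hφ'⟩ ⟨hk, ψ, hψ, hψ'⟩
    have hc : φ (gen G c) = gen G c := by simp [hφ', hj]
    refine ⟨by simp [hj, hk], φ * ψ, mul_mem hφ hψ, fun w => ?_⟩
    rw [MulAut.mul_apply, hψ', map_mul, map_zpow, hc, hφ', ← mul_assoc, ← zpow_add, add_comm,
      Pi.add_apply]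
  neg_mem' := by
    rintro j ⟨hj, φ, hφ, hφ'⟩
    have hc : φ (gen G c) = gen G c := by simp [hφ', hj]
    refine ⟨by simp [hj], φ⁻¹, inv_mem hφ, fun w => ?_⟩
    apply φ.injective
    rw [MulAut.apply_inv_self, map_mul, map_zpow, hc, hφ', ← mul_assoc, ← zpow_add, Pi.neg_apply,
      neg_add_cancel, zpow_zero, one_mul]

theorem mem_transVectors [Fintype V] {j : V → ℤ} (hc : j c = 0)
    (h : ∀ v, j v ≠ 0 → Dominates G c v) : j ∈ transVectors G c := by
  classical
  rw [← Finset.univ_sum_single j]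
  refine AddSubgroup.sum_mem _ fun v _ => ?_
  by_cases hv : j v = 0
  · rw [hv, Pi.single_zero]
    exact zero_mem _
  have hcv : c ≠ v := fun h => hv (h ▸ hc)
  have : Pi.single v (j v) = j v • (Pi.single v 1 : V → ℤ) := by
    rw [← Pi.single_smul, smul_eq_mul, mul_one]
  rw [this]
  refine AddSubgroup.zsmul_mem _ ?_ _
  obtain ⟨φ, hφ⟩ := exists_isTransvection (h v hv) hcv
  refine ⟨Pi.single_eq_of_ne hcv _, φ, Subgroup.subset_closure (Or.inl ⟨c, v, hφ⟩), fun w => ?_⟩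
  by_cases hw : w = v
  · subst hw; simp [hφ.2.2.1]
  · simp [hφ.2.2.2 w hw, hw]

theorem notMem_star_of_isCompOf {P : Set V} (hP : IsCompOf G (_root_.star G v)ᶜ P) {u : V}
    (hu : u ∈ P) : u ∉ _root_.star G v := by
  obtain ⟨x, rfl⟩ := hP
  obtain ⟨y, -, rfl⟩ := hu
  exact y.2

theorem mem_of_isCompOf_of_adj {P : Set V} (hP : IsCompOf G (_root_.star G v)ᶜ P) {u w : V}
    (hu : u ∈ P) (huw : G.Adj u w) (hw : w ∉ _root_.star G v) : w ∈ P := by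
  obtain ⟨x, rfl⟩ := hP
  obtain ⟨y, hy, rfl⟩ := hu
  have hadj : (G.induce (_root_.star G v)ᶜ).Adj y ⟨w, hw⟩ := huw
  exact ⟨⟨w, hw⟩, hy.trans hadj.reachable, rfl⟩

theorem not_adj_of_isCompOf {P : Set V} (hP : IsCompOf G (_root_.star G v)ᶜ P) {u : V}
    (hu : u ∈ P) : u ≠ v ∧ ¬G.Adj v u := by
  simpa [mem_star] using notMem_star_of_isCompOf hP hu

open Classical in
/-- Powers of a partial conjugation. -/
def pconjHom {P : Set V} (hP : IsCompOf G (_root_.star G v)ᶜ P) (n : ℤ) : RAAG G →* RAAG G :=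
  lift (fun w => if w ∈ P then gen G v ^ n * gen G w * (gen G v ^ n)⁻¹ else gen G w) (by
    have key (u w : V) (hu : u ∈ P) (hw : w ∉ P) (huw : G.Adj u w) :
        Commute (gen G v ^ n * gen G u * (gen G v ^ n)⁻¹) (gen G w) := by
      have hvw : Commute (gen G v ^ n) (gen G w) := by
        refine Commute.zpow_left ?_ n
        have : w ∈ _root_.star G v := by
          by_contra h
          exact hw (mem_of_isCompOf_of_adj hP hu huw h)
        rcases this with rfl | h
        · rfl
        · exact commute_gen h
      exact (hvw.mul_left (commute_gen huw)).mul_left hvw.inv_left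
    intro u w huw
    split_ifs with hu hw hw
    · exact (commute_gen huw).map (MulAut.conj (gen G v ^ n))
    · exact key u w hu hw huw
    · exact (key w u hw hu huw.symm).symm
    · exact commute_gen huw)

theorem pconjHom_mem {P : Set V} (hP : IsCompOf G (_root_.star G v)ᶜ P) (n : ℤ) {w : V}
    (hw : w ∈ P) : pconjHom hP n (gen G w) = gen G v ^ n * gen G w * (gen G v ^ n)⁻¹ := by
  simp [pconjHom, hw]

theorem pconjHom_notMem {P : Set V} (hP : IsCompOf G (_root_.star G v)ᶜ P) (n : ℤ) {w : V}
    (hw : w ∉ P) : pconjHom hP n (gen G w) = gen G w := by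
  simp [pconjHom, hw]

theorem pconjHom_comp {P : Set V} (hP : IsCompOf G (_root_.star G v)ᶜ P) {m n : ℤ}
    (hmn : m + n = 0) (w : V) : pconjHom hP m (pconjHom hP n (gen G w)) = gen G w := by
  have hv : v ∉ P := fun h => (not_adj_of_isCompOf hP h).1 rfl
  by_cases hw : w ∈ P
  · obtain rfl : m = -n := by omega
    rw [pconjHom_mem hP n hw, map_mul, map_mul, map_inv, map_zpow, pconjHom_notMem hP _ hv,
      pconjHom_mem hP _ hw]
    group
  · rw [pconjHom_notMem hP n hw, pconjHom_notMem hP m hw]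

theorem exists_isPartialConj {P : Set V} (hP : IsCompOf G (_root_.star G v)ᶜ P) :
    ∃ φ : MulAut (RAAG G), IsPartialConj G φ v P :=
  ⟨mkAut (pconjHom hP 1) (pconjHom hP (-1)) (pconjHom_comp hP (by simp))
      (pconjHom_comp hP (by simp)), hP, fun u hu => by simp [pconjHom_mem hP 1 hu],
    fun u hu => by simp [pconjHom_notMem hP 1 hu]⟩

/-- The exponent vectors of the products of partial conjugations by `v`. -/
def pconjVectors (G : SimpleGraph V) (v : V) : AddSubgroup (V → ℤ) where
  carrier := {k | ∃ φ ∈ PCT G, ∀ w, φ (gen G w) = gen G v ^ k w * gen G w * (gen G v ^ k w)⁻¹}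
  zero_mem' := ⟨1, one_mem _, fun w => by simp⟩
  add_mem' := by
    rintro j k ⟨φ, hφ, hφ'⟩ ⟨ψ, hψ, hψ'⟩
    have hc : φ (gen G v) = gen G v := by rw [hφ']; group
    refine ⟨φ * ψ, mul_mem hφ hψ, fun w => ?_⟩
    rw [MulAut.mul_apply, hψ', map_mul, map_mul, map_inv, map_zpow, hc, hφ', Pi.add_apply,
      add_comm, zpow_add]
    group
  neg_mem' := by
    rintro j ⟨φ, hφ, hφ'⟩
    have hc : φ (gen G v) = gen G v := by rw [hφ']; group
    refine ⟨φ⁻¹, inv_mem hφ, fun w => ?_⟩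
    apply φ.injective
    rw [MulAut.apply_inv_self, map_mul, map_mul, map_inv, map_zpow, hc, hφ', Pi.neg_apply]
    group

theorem commute_gen_of_mem_star {w : V} (hw : w ∈ _root_.star G v) :
    Commute (gen G v) (gen G w) := by
  rcases hw with rfl | h
  · rfl
  · exact commute_gen h

theorem mem_pconjVectors [Finite V] {k : V → ℤ}
    (hk : ∀ u w, u ∉ _root_.star G v → w ∉ _root_.star G v → G.Adj u w → k u = k w) :
    k ∈ pconjVectors G v := by
  classical
  let H := G.induce (_root_.star G v)ᶜ
  have : Fintype H.ConnectedComponent := Fintype.ofFinite _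
  have hreach (x y : ((_root_.star G v)ᶜ : Set V)) (h : H.Reachable x y) : k x = k y := by
    obtain ⟨p⟩ := h
    induction p with
    | nil => rfl
    | @cons a b _ hadj _ ih => exact (hk _ _ a.2 b.2 hadj).trans ih
  let comp (C : H.ConnectedComponent) : Set V := Subtype.val '' C.supp
  have hcomp (C : H.ConnectedComponent) : IsCompOf G (_root_.star G v)ᶜ (comp C) := by
    induction C using SimpleGraph.ConnectedComponent.ind with
    | _ x =>
      refine ⟨x, ?_⟩
      simp only [comp]
      congr 1
      ext y
      rw [SimpleGraph.ConnectedComponent.mem_supp_iff, SimpleGraph.ConnectedComponent.eq]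
      exact SimpleGraph.reachable_comm
  have hsum : k = (∑ C : H.ConnectedComponent, k C.out • (comp C).indicator 1) +
      (_root_.star G v).indicator k := by
    ext w
    rw [Pi.add_apply, Finset.sum_apply]
    by_cases hw : w ∈ _root_.star G v
    · rw [Finset.sum_eq_zero, Set.indicator_of_mem hw, zero_add]
      intro C _
      rw [Pi.smul_apply, Set.indicator_of_notMem, smul_zero]
      exact fun h => notMem_star_of_isCompOf (hcomp C) h hw
    · rw [Set.indicator_of_notMem hw, add_zero,
        Finset.sum_eq_single (H.connectedComponentMk ⟨w, hw⟩)]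
      · rw [Pi.smul_apply, Set.indicator_of_mem
          (show w ∈ comp _ from ⟨⟨w, hw⟩, rfl, rfl⟩), Pi.one_apply, smul_eq_mul,
          mul_one]
        refine hreach ⟨w, hw⟩ _ (SimpleGraph.ConnectedComponent.exact ?_)
        exact (Quot.out_eq (H.connectedComponentMk ⟨w, hw⟩)).symm
      · intro C _ hC
        rw [Pi.smul_apply, Set.indicator_of_notMem, smul_zero]
        rintro ⟨y, hy, rfl⟩
        exact hC hy.symm
      · simp
  rw [hsum]
  refine add_mem (AddSubgroup.sum_mem _ fun C _ => AddSubgroup.zsmul_mem _ ?_ _) ?_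
  · obtain ⟨φ, hφ⟩ := exists_isPartialConj (hcomp C)
    refine ⟨φ, Subgroup.subset_closure (Or.inr ⟨v, _, hφ⟩), fun w => ?_⟩
    by_cases hw : w ∈ comp C
    · simp [hφ.2.1 w hw, hw]
    · simp [hφ.2.2 w hw, hw]
  · refine ⟨1, one_mem _, fun w => ?_⟩
    by_cases hw : w ∈ _root_.star G v
    · rw [((commute_gen_of_mem_star hw).zpow_left _).eq, mul_inv_cancel_right, MulAut.one_apply]
    · simp [hw]

theorem inn_le_pct [Finite V] : Inn (RAAG G) ≤ PCT G := by
  rintro _ ⟨g, rfl⟩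
  refine hom_mem_of_gen _ _ (fun v => ?_) g
  obtain ⟨φ, hφ, hφ'⟩ := mem_pconjVectors (G := G) (v := v) (k := fun _ => 1)
    (fun _ _ _ _ _ => rfl)
  convert hφ
  refine aut_ext fun w => ?_
  rw [hφ', zpow_one]
  rfl

theorem pct_le_ker_diagHom [Fintype V] (hF : Focused G c) (hT : TrivialAut G) :
    PCT G ≤ (diagHom hF hT).ker := by
  rw [PCT, Subgroup.closure_le]
  rintro φ (⟨u, v, huv, -, h1, h2⟩ | ⟨v, P, -, h1, h2⟩) <;>
    refine MonoidHom.mem_ker.2 (funext fun w => ?_) <;> rw [diagHom_apply]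
  · by_cases hw : w = v
    · subst hw; simp [h1, expo_gen_of_ne huv]
    · simp [h2 w hw]
  · by_cases hw : w ∈ P
    · simp [h1 w hw]
    · simp [h2 w hw]

end RAAG

namespace RAAG

variable {V : Type} {G : SimpleGraph V} {c v : V}

/-- Three cosets of standard subgroups that meet pairwise have a common element. -/
theorem exists_mem_three_cosets {S T U : Set V} {x y z : RAAG G} (hS : x⁻¹ * z ∈ par G S)
    (hT : x⁻¹ * y ∈ par G T) (hU : z⁻¹ * y ∈ par G U) :
    ∃ w, x⁻¹ * w ∈ par G S ∧ x⁻¹ * w ∈ par G T ∧ z⁻¹ * w ∈ par G U := by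
  set s := x⁻¹ * z with hs
  set t := x⁻¹ * y with ht
  have hst : z⁻¹ * y = s⁻¹ * t := by rw [hs, ht]; group
  have h1 : s * (ret U s)⁻¹ = t * (ret U t)⁻¹ := by
    have := ret_eq_self hU
    rw [hst, map_mul, map_inv] at this
    have h2 : t = s * ((ret U s)⁻¹ * ret U t) := by rw [this]; group
    calc s * (ret U s)⁻¹ = s * ((ret U s)⁻¹ * ret U t) * (ret U t)⁻¹ := by group
      _ = _ := by rw [← h2]
  refine ⟨x * (s * (ret U s)⁻¹), ?_, ?_, ?_⟩
  · rw [inv_mul_cancel_left]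
    exact mul_mem hS (inv_mem (par_mono Set.inter_subset_right (ret_mem_par_inter hS)))
  · rw [inv_mul_cancel_left, h1]
    exact mul_mem hT (inv_mem (par_mono Set.inter_subset_right (ret_mem_par_inter hT)))
  · have : z⁻¹ * (x * (s * (ret U s)⁻¹)) = (ret U s)⁻¹ := by rw [hs]; group
    rw [this]
    exact inv_mem (ret_mem_par _ _)

/-- The Helly property for cosets of standard subgroups. -/
theorem exists_mem_cosets {ι : Type*} [DecidableEq ι] (F : Finset ι) (g : ι → RAAG G)
    (S : ι → Set V) (h : ∀ i ∈ F, ∀ j ∈ F, i ≠ j →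
      ∃ x, (g i)⁻¹ * x ∈ par G (S i) ∧ (g j)⁻¹ * x ∈ par G (S j)) :
    ∃ x, ∀ i ∈ F, (g i)⁻¹ * x ∈ par G (S i) := by
  induction F using Finset.induction_on generalizing g S with
  | empty => exact ⟨1, by simp⟩
  | insert a F ha ih =>
    have h1 : ∀ i, ∃ x, i ∈ F → (g i)⁻¹ * x ∈ par G (S i) ∧ (g a)⁻¹ * x ∈ par G (S a) := by
      intro i
      by_cases hi : i ∈ F
      · obtain ⟨x, hx⟩ := h i (by simp [hi]) a (by simp) (fun h => ha (h ▸ hi))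
        exact ⟨x, fun _ => hx⟩
      · exact ⟨1, fun h => absurd h hi⟩
    choose g' hg' using h1
    have trans {x y z : RAAG G} {T : Set V} (h1 : x⁻¹ * y ∈ par G T) (h2 : x⁻¹ * z ∈ par G T) :
        y⁻¹ * z ∈ par G T := by
      have : y⁻¹ * z = (x⁻¹ * y)⁻¹ * (x⁻¹ * z) := by group
      rw [this]
      exact mul_mem (inv_mem h1) h2
    have trans' {x y z : RAAG G} {T : Set V} (h1 : x⁻¹ * y ∈ par G T) (h2 : y⁻¹ * z ∈ par G T) :
        x⁻¹ * z ∈ par G T := by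
      have : x⁻¹ * z = (x⁻¹ * y) * (y⁻¹ * z) := by group
      rw [this]
      exact mul_mem h1 h2
    obtain ⟨x, hx⟩ := ih g' (fun i => S i ∩ S a) (by
      intro i hi j hj hij
      obtain ⟨y, hy1, hy2⟩ := h i (by simp [hi]) j (by simp [hj]) hij
      obtain ⟨w, hw1, hw2, hw3⟩ := exists_mem_three_cosets (x := g' i) (z := g' j) (y := y)
        (trans (hg' i hi).2 (hg' j hj).2) (trans (hg' i hi).1 hy1) (trans (hg' j hj).1 hy2)
      refine ⟨w, mem_par_inter hw2 hw1, mem_par_inter hw3 ?_⟩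
      exact trans (trans' (trans (hg' i hi).2 (hg' j hj).2) (by simp))
        hw1)
    rcases F.eq_empty_or_nonempty with rfl | ⟨i, hi⟩
    · exact ⟨g a, by simp⟩
    refine ⟨x, fun j hj => ?_⟩
    rcases Finset.mem_insert.1 hj with rfl | hj
    · exact trans' (hg' i hi).2 (par_mono Set.inter_subset_right (hx i hi))
    · exact trans' (hg' j hj).1 (par_mono Set.inter_subset_left (hx j hj))

theorem exists_adj_notMem_star (hF : Focused G c) (hv : v ≠ c) {w : V} (hw : w ≠ v) :
    ∃ z, G.Adj w z ∧ z ∉ _root_.star G v := by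
  by_contra! h
  exact hv (hF.1 v w hw.symm fun z hz => h z hz)

theorem expo_conj (w : V) (g x : RAAG G) : expo w (g⁻¹ * x * g) = expo w x := by
  simp only [expo_mul, expo_inv]
  ring

theorem conj_apply_mem_of_adj {φ : MulAut (RAAG G)} (hφ : ∀ w x, expo w (φ x) = expo w x)
    {w z : V} (hz : z ∉ _root_.star G v) (hzw : G.Adj z w)
    {g : RAAG G} (hg : g⁻¹ * φ (gen G z) * g ∈ par G {v}ᶜ) :
    g⁻¹ * φ (gen G w) * g ∈ par G {v}ᶜ := by
  rw [mem_star, not_or] at hz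
  refine mem_par_compl_of_conj hz.2 hg ?_ (z := z) ?_
  · have h1 : φ (gen G z) * φ (gen G w) = φ (gen G w) * φ (gen G z) :=
      ((commute_gen hzw).map φ).eq
    convert hg using 1
    have : (g⁻¹ * φ (gen G w) * g)⁻¹ * (g⁻¹ * φ (gen G z) * g) * (g⁻¹ * φ (gen G w) * g) =
        g⁻¹ * ((φ (gen G w))⁻¹ * (φ (gen G z) * φ (gen G w))) * g := by group
    rw [this, h1]
    group
  · rw [expo_conj, hφ]
    simp

theorem exists_conj_apply_mem {φ : MulAut (RAAG G)} (hφ : ∀ w x, expo w (φ x) = expo w x)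
    (hF : Focused G c) (hv : v ≠ c) :
    ∃ g : RAAG G, ∀ w, w ≠ v → g⁻¹ * φ (gen G w) * g ∈ par G {v}ᶜ := by
  have hconn := hF.2 v hv
  obtain ⟨⟨x, hx⟩⟩ := hconn.nonempty
  have hx' : x ≠ v ∧ ¬G.Adj v x := by simpa [mem_star] using hx
  obtain ⟨z, hxz, hz⟩ := exists_adj_notMem_star hF hv hx'.1
  have hz' : z ≠ v ∧ ¬G.Adj v z := by simpa [mem_star] using hz
  obtain ⟨g, hg, -⟩ := exists_conj_mem_par_compl hx'.1 hx'.2 hz'.1 hz'.2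
    ((commute_gen hxz).map φ) (by simp [hφ]) (by simp [hφ, expo_gen_of_ne (G.ne_of_adj hxz)])
    (by simp [hφ, expo_gen_of_ne (G.ne_of_adj hxz).symm]) (by simp [hφ])
  have h1 : ∀ y : ((_root_.star G v)ᶜ : Set V), g⁻¹ * φ (gen G y) * g ∈ par G {v}ᶜ := by
    intro y
    have h2 (a b : ((_root_.star G v)ᶜ : Set V)) (p : (G.induce (_root_.star G v)ᶜ).Walk a b)
        (hb : g⁻¹ * φ (gen G b) * g ∈ par G {v}ᶜ) : g⁻¹ * φ (gen G a) * g ∈ par G {v}ᶜ := by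
      induction p with
      | nil => exact hb
      | @cons a b _ hadj _ ih =>
        exact conj_apply_mem_of_adj hφ b.2 (SimpleGraph.Adj.symm hadj) (ih hb)
    obtain ⟨p⟩ := hconn.preconnected y ⟨x, hx⟩
    exact h2 _ _ p hg
  refine ⟨g, fun w hw => ?_⟩
  obtain ⟨y, hwy, hy⟩ := exists_adj_notMem_star hF hv hw
  exact conj_apply_mem_of_adj hφ hy hwy.symm (h1 ⟨y, hy⟩)

theorem exists_mem_two_cosets {φ : MulAut (RAAG G)} (hφ : ∀ w x, expo w (φ x) = expo w x)
    (hF : Focused G c) {u : V} (huv : u ≠ v) (hu : u ≠ c)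
    {g h : RAAG G} (hg : ∀ w, w ≠ v → g⁻¹ * φ (gen G w) * g ∈ par G {v}ᶜ)
    (hh : ∀ w, w ≠ u → h⁻¹ * φ (gen G w) * h ∈ par G {u}ᶜ) :
    ∃ x, g⁻¹ * x ∈ par G {v}ᶜ ∧ h⁻¹ * x ∈ par G {u}ᶜ := by
  obtain ⟨w, hwu, hwv⟩ : ∃ w, w ∉ _root_.star G u ∧ w ≠ v := by
    by_contra! hno
    refine hu (hF.1 u v huv fun y hy => ?_)
    by_contra hyu
    exact G.ne_of_adj hy (hno y hyu).symm
  rw [mem_star, not_or] at hwu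
  set k := g⁻¹ * h with hk
  set r := ret {v}ᶜ k with hr
  have hs := hg w hwv
  set s := g⁻¹ * φ (gen G w) * g with hs'
  have h1 : k⁻¹ * s * k ∈ par G {u}ᶜ := by
    convert hh w hwu.1 using 1
    rw [hs', hk]
    group
  have h2 : r⁻¹ * s * r ∈ par G {u}ᶜ := by
    have := par_mono Set.inter_subset_right (ret_mem_par_inter (S := {v}ᶜ) h1)
    rwa [map_mul, map_mul, map_inv, ret_eq_self hs] at this
  have h3 : r⁻¹ * k ∈ par G {u}ᶜ := by
    refine mem_par_compl_of_conj hwu.2 h2 ?_ ?_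
    · convert h1 using 1
      group
    · rw [expo_conj, hs', expo_conj, hφ]
      simp
  refine ⟨g * r, by simpa using ret_mem_par _ _, ?_⟩
  convert inv_mem h3 using 1
  rw [hk]
  group

/-- An automorphism acting trivially on the abelianization is, up to an inner automorphism,
given by preserving each standard subgroup generated by `c` and one further vertex. -/
theorem exists_conj_apply_mem_par_pair [Fintype V] {φ : MulAut (RAAG G)}
    (hφ : ∀ w x, expo w (φ x) = expo w x) (hF : Focused G c) :
    ∃ g : RAAG G, ∀ w, g⁻¹ * φ (gen G w) * g ∈ par G {c, w} := by
  classical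
  have h1 : ∀ v, ∃ g : RAAG G, v ≠ c → ∀ w, w ≠ v → g⁻¹ * φ (gen G w) * g ∈ par G {v}ᶜ := by
    intro v
    by_cases hv : v = c
    · exact ⟨1, fun h => absurd hv h⟩
    · obtain ⟨g, hg⟩ := exists_conj_apply_mem hφ hF hv
      exact ⟨g, fun _ => hg⟩
  choose g hg using h1
  obtain ⟨x, hx⟩ := exists_mem_cosets ({c}ᶜ : Finset V) g (fun v => {v}ᶜ)
    (by
      intro v hv u hu hvu
      have hv' : v ≠ c := by simpa using hv
      have hu' : u ≠ c := by simpa using hu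
      exact exists_mem_two_cosets hφ hF hvu.symm hu' (hg v hv') (hg u hu'))
  refine ⟨x, fun w => ?_⟩
  have h2 := mem_par_compl_finset ({c, w}ᶜ : Finset V) (x := x⁻¹ * φ (gen G w) * x) (by
    intro v hv
    have hv' : v ≠ c ∧ v ≠ w := by simpa using hv
    have h3 := hx v (by simpa using hv'.1)
    have h4 := mul_mem (mul_mem (inv_mem h3) (hg v hv'.1 w hv'.2.symm)) h3
    convert h4 using 1
    group)
  convert h2 using 2
  ext y
  simp [imp_iff_not_or, or_comm]

end RAAG

namespace FreeGroup

/-- An element of the free group of rank two is bounded by the second generator if its reduced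
word is nonempty and starts and ends with a power of that generator. -/
def IsBounded (x : FreeGroup Bool) : Prop :=
  x ≠ 1 ∧ (∀ a ∈ x.toWord.head?, a.1 = false) ∧ ∀ a ∈ x.toWord.getLast?, a.1 = false

theorem toWord_mul_of_ne {x y : FreeGroup Bool}
    (h : ∀ a ∈ x.toWord.getLast?, ∀ b ∈ y.toWord.head?, a.1 ≠ b.1) :
    (x * y).toWord = x.toWord ++ y.toWord := by
  have h1 : IsReduced (x.toWord ++ y.toWord) :=
    List.isChain_append.2 ⟨isReduced_toWord, isReduced_toWord,
      fun a ha b hb hab => absurd hab (h a ha b hb)⟩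
  rw [toWord_mul, h1.reduce_eq]

theorem fst_of_mem_toWord_zpow {b : Bool} (n : ℤ) {a : Bool × Bool}
    (ha : a ∈ (of b ^ n).toWord) : a.1 = b := by
  have key (n : ℕ) (a : Bool × Bool) (ha : a ∈ (of b ^ n).toWord) : a.1 = b := by
    rw [toWord_of_pow] at ha
    rw [List.eq_of_mem_replicate ha]
  obtain ⟨n, rfl | rfl⟩ := n.eq_nat_or_neg
  · exact key n a (by simpa using ha)
  · rw [zpow_neg, toWord_inv, zpow_natCast] at ha
    simp only [invRev, List.mem_reverse, List.mem_map] at ha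
    obtain ⟨a', ha', rfl⟩ := ha
    exact key n a' ha'

theorem of_zpow_ne_one {b : Bool} {n : ℤ} (hn : n ≠ 0) : (of b) ^ n ≠ 1 := by
  intro h
  have := congrArg (FreeGroup.lift fun _ => Multiplicative.ofAdd (1 : ℤ)) h
  rw [map_zpow, lift_apply_of, MonoidHom.map_one, ← ofAdd_zsmul] at this
  exact hn (by simpa using this)

theorem exists_eq_mul_isBounded_mul (g : FreeGroup Bool) :
    (∃ n : ℤ, g = of true ^ n) ∨
      ∃ (a b : ℤ) (x : FreeGroup Bool), x.IsBounded ∧ g = of true ^ a * x * of true ^ b := by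
  induction hn : g.norm using Nat.strong_induction_on generalizing g with
  | _ n ih =>
    by_cases h1 : g = 1
    · exact Or.inl ⟨0, by simpa using h1⟩
    have hmk (s : Bool) : ∃ i : ℤ, mk [(true, s)] = of true ^ i := by
      cases s
      · exact ⟨-1, by rw [zpow_neg_one]; rfl⟩
      · exact ⟨1, by rw [zpow_one]; rfl⟩
    by_cases hhead : ∀ a ∈ g.toWord.head?, a.1 = false
    · by_cases hlast : ∀ a ∈ g.toWord.getLast?, a.1 = false
      · exact Or.inr ⟨0, 0, g, ⟨h1, hhead, hlast⟩, by simp⟩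
      · push Not at hlast
        obtain ⟨⟨e, s⟩, ha, hs⟩ := hlast
        obtain rfl : e = true := by simpa using hs
        obtain ⟨L, hL⟩ := List.mem_getLast?_eq_getLast ha |> fun ⟨h, h'⟩ =>
          (⟨_, (List.dropLast_append_getLast h).symm.trans (by rw [← h'])⟩ :
            ∃ L, g.toWord = L ++ [(true, s)])
        obtain ⟨i, hi⟩ := hmk s
        have hg : g = mk L * of true ^ i := by
          rw [← hi, mul_mk, ← hL, mk_toWord]
        have hlt : (mk L).norm < n := by
          have h2 := norm_mk_le (L₁ := L)
          have h3 : g.norm = L.length + 1 := by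
            change g.toWord.length = _
            simp [hL]
          omega
        rcases ih _ hlt _ rfl with ⟨m, hm⟩ | ⟨a, b, x, hx, hm⟩
        · exact Or.inl ⟨m + i, by rw [hg, hm, zpow_add]⟩
        · exact Or.inr ⟨a, b + i, x, hx, by rw [hg, hm, zpow_add]; group⟩
    · push Not at hhead
      obtain ⟨⟨e, s⟩, ha, hs⟩ := hhead
      obtain rfl : e = true := by simpa using hs
      obtain ⟨L, hL⟩ := List.head?_eq_some_iff.1 ha
      obtain ⟨i, hi⟩ := hmk s
      have hg : g = of true ^ i * mk L := by
        rw [← hi, mul_mk, List.singleton_append, ← hL, mk_toWord]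
      have hlt : (mk L).norm < n := by
        have h2 := norm_mk_le (L₁ := L)
        have h3 : g.norm = L.length + 1 := by
          change g.toWord.length = _
          simp [hL]
        omega
      rcases ih _ hlt _ rfl with ⟨m, hm⟩ | ⟨a, b, x, hx, hm⟩
      · exact Or.inl ⟨i + m, by rw [hg, hm, zpow_add]⟩
      · exact Or.inr ⟨i + a, b, x, hx, by rw [hg, hm, zpow_add]; group⟩

theorem IsBounded.inv {x : FreeGroup Bool} (h : x.IsBounded) : x⁻¹.IsBounded := by
  refine ⟨inv_ne_one.2 h.1, ?_, ?_⟩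
  · intro a ha
    rw [toWord_inv, invRev, List.head?_reverse, List.getLast?_map] at ha
    obtain ⟨b, hb, rfl⟩ := Option.mem_map.1 ha
    exact h.2.2 b hb
  · intro a ha
    rw [toWord_inv, invRev, List.getLast?_reverse, List.head?_map] at ha
    obtain ⟨b, hb, rfl⟩ := Option.mem_map.1 ha
    exact h.2.1 b hb

theorem toWord_pow_succ {X : Type*} [DecidableEq X] (x : FreeGroup X) (n : ℕ) :
    (x ^ (n + 1)).toWord = reduceCyclically.conjugator x.toWord ++
      (List.replicate (n + 1) (reduceCyclically x.toWord)).flatten ++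
      invRev (reduceCyclically.conjugator x.toWord) := by
  rw [← reduceCyclically.reduce_flatten_replicate_succ isReduced_toWord, ← toWord_mk]
  congr 1
  conv_lhs => rw [← mk_toWord (x := x), pow_mk]

theorem IsBounded.pow_succ {x : FreeGroup Bool} (h : x.IsBounded) (n : ℕ) :
    (x ^ (n + 1)).IsBounded := by
  have h0 := reduceCyclically.conj_conjugator_reduceCyclically x.toWord
  refine ⟨?_, ?_, ?_⟩
  · exact fun h1 => h.1 (by simpa using h1)
  · intro a ha
    apply h.2.1
    rw [← h0]
    rw [toWord_pow_succ] at ha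
    rwa [List.head?_append, List.head?_append, List.head?_flatten_replicate (by simp),
      ← List.head?_append, ← List.head?_append] at ha
  · intro a ha
    apply h.2.2
    rw [← h0]
    rw [toWord_pow_succ] at ha
    rwa [List.getLast?_append, List.getLast?_append, List.getLast?_flatten_replicate (by simp),
      ← List.getLast?_append, ← List.getLast?_append] at ha

theorem IsBounded.zpow {x : FreeGroup Bool} (h : x.IsBounded) {m : ℤ} (hm : m ≠ 0) :
    (x ^ m).IsBounded := by
  obtain ⟨n, rfl | rfl⟩ := m.eq_nat_or_neg
  · obtain ⟨k, rfl⟩ := Nat.exists_eq_succ_of_ne_zero (by simpa using hm)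
    rw [zpow_natCast]
    exact h.pow_succ k
  · obtain ⟨k, rfl⟩ := Nat.exists_eq_succ_of_ne_zero (by simpa using hm)
    rw [zpow_neg, zpow_natCast]
    exact (h.pow_succ k).inv

/-- Alternating products of nonzero powers of `x` and of the first generator, starting with a power
of `x`. -/
inductive IsAlternating (x : FreeGroup Bool) : FreeGroup Bool → Prop
  | base {m : ℤ} (hm : m ≠ 0) (b : ℤ) : IsAlternating x (x ^ m * of true ^ b)
  | step {m n : ℤ} (hm : m ≠ 0) (hn : n ≠ 0) {y : FreeGroup Bool} (hy : IsAlternating x y) :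
      IsAlternating x (x ^ m * (of true ^ n * y))

/-- The number of occurrences of the second generator in the reduced word. -/
def syllables (x : FreeGroup Bool) : ℕ := x.toWord.countP fun a => a.1 = false

theorem IsBounded.one_le_syllables {x : FreeGroup Bool} (h : x.IsBounded) : 1 ≤ x.syllables := by
  rcases hL : x.toWord with _ | ⟨a, L⟩
  · exact absurd (toWord_eq_nil_iff.1 hL) h.1
  · rw [syllables, Nat.one_le_iff_ne_zero, ← Nat.pos_iff_ne_zero, List.countP_pos_iff]
    exact ⟨a, by simp [hL], by simpa using h.2.1 a (by simp [hL])⟩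

theorem head_mul_of_isBounded {x y : FreeGroup Bool} (hx : x.IsBounded)
    (hy : ∀ a ∈ y.toWord.head?, a.1 = true) :
    (x * y).toWord = x.toWord ++ y.toWord :=
  toWord_mul_of_ne fun a ha b hb => by simp [hx.2.2 a ha, hy b hb]

theorem IsAlternating.head_and_syllables {x y : FreeGroup Bool} (hx : x.IsBounded)
    (hy : IsAlternating x y) : (∀ a ∈ y.toWord.head?, a.1 = false) ∧ 1 ≤ y.syllables ∧
      ((∃ m b : ℤ, y = x ^ m * of true ^ b) ∨ 2 ≤ y.syllables) := by
  have head_app {m : ℤ} (hm : m ≠ 0) {z : FreeGroup Bool}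
      (hz : ∀ a ∈ z.toWord.head?, a.1 = true) :
      (∀ a ∈ (x ^ m * z).toWord.head?, a.1 = false) ∧
        1 + z.syllables ≤ (x ^ m * z).syllables := by
    have hb := hx.zpow hm
    have h1 := head_mul_of_isBounded hb hz
    constructor
    · intro a ha
      have hne : (x ^ m).toWord ≠ [] := fun h => hb.1 (toWord_eq_nil_iff.1 h)
      rw [h1, List.head?_append_of_ne_nil _ hne] at ha
      exact hb.2.1 a ha
    · have := hb.one_le_syllables
      simp only [syllables, h1, List.countP_append] at this ⊢
      omega
  induction hy with
  | base hm b =>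
    have h1 := head_app hm (z := of true ^ b) fun a ha =>
      fst_of_mem_toWord_zpow b (List.mem_of_mem_head? ha)
    exact ⟨h1.1, by omega, Or.inl ⟨_, _, rfl⟩⟩
  | @step m n hm hn y _ ih =>
    have h2 : (of true ^ n * y).toWord = (of true ^ n).toWord ++ y.toWord :=
      toWord_mul_of_ne fun a ha b hb => by
        rw [ih.1 b hb, fst_of_mem_toWord_zpow n (List.mem_of_getLast? ha)]
        simp
    have h3 : (of true ^ n : FreeGroup Bool).toWord ≠ [] :=
      fun h => of_zpow_ne_one hn (toWord_eq_nil_iff.1 h)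
    have h1 := head_app hm (z := of true ^ n * y) fun a ha => by
      rw [h2, List.head?_append_of_ne_nil _ h3] at ha
      exact fst_of_mem_toWord_zpow n (List.mem_of_mem_head? ha)
    have h4 : y.syllables ≤ (of true ^ n * y).syllables := by
      simp only [syllables, h2, List.countP_append]
      omega
    exact ⟨h1.1, by omega, Or.inr (by omega)⟩

theorem eq_zpow_or_isAlternating {x y : FreeGroup Bool}
    (hy : y ∈ Subgroup.closure {of true, x}) :
    (∃ n : ℤ, y = of true ^ n) ∨ ∃ (n : ℤ) (z : FreeGroup Bool), IsAlternating x z ∧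
      y = of true ^ n * z := by
  have key (e : ℤ) (he : e ≠ 0) (y : FreeGroup Bool)
      (ih : (∃ n : ℤ, y = of true ^ n) ∨ ∃ (n : ℤ) (z : FreeGroup Bool), IsAlternating x z ∧
        y = of true ^ n * z) :
      (∃ n : ℤ, x ^ e * y = of true ^ n) ∨ ∃ (n : ℤ) (z : FreeGroup Bool),
        IsAlternating x z ∧ x ^ e * y = of true ^ n * z := by
    rcases ih with ⟨n, rfl⟩ | ⟨n, z, hz, rfl⟩
    · exact Or.inr ⟨0, _, .base he n, by simp⟩
    by_cases hn : n = 0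
    · subst hn
      cases hz with
      | @base m hm b =>
        by_cases hme : e + m = 0
        · exact Or.inl ⟨b, by rw [zpow_zero, one_mul, ← mul_assoc, ← zpow_add, hme]; simp⟩
        · exact Or.inr ⟨0, _, .base hme b, by
            rw [zpow_zero, one_mul, one_mul, ← mul_assoc, ← zpow_add]⟩
      | @step m n hm hn y hy =>
        by_cases hme : e + m = 0
        · exact Or.inr ⟨n, y, hy, by
            rw [zpow_zero, one_mul, ← mul_assoc, ← zpow_add, hme]; simp⟩
        · exact Or.inr ⟨0, _, .step hme hn hy, by
            rw [zpow_zero, one_mul, one_mul, ← mul_assoc, ← zpow_add]⟩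
    · exact Or.inr ⟨0, _, .step he hn hz, by simp⟩
  have key' (e : ℤ) (y : FreeGroup Bool)
      (ih : (∃ n : ℤ, y = of true ^ n) ∨ ∃ (n : ℤ) (z : FreeGroup Bool), IsAlternating x z ∧
        y = of true ^ n * z) :
      (∃ n : ℤ, of true ^ e * y = of true ^ n) ∨ ∃ (n : ℤ) (z : FreeGroup Bool),
        IsAlternating x z ∧ of true ^ e * y = of true ^ n * z := by
    rcases ih with ⟨n, rfl⟩ | ⟨n, z, hz, rfl⟩
    · exact Or.inl ⟨e + n, by rw [zpow_add]⟩
    · exact Or.inr ⟨e + n, z, hz, by rw [zpow_add, mul_assoc]⟩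
  induction hy using Subgroup.closure_induction_left with
  | one => exact Or.inl ⟨0, by simp⟩
  | mul_left a ha y _ ih =>
    rcases ha with rfl | rfl
    · simpa using key' 1 y ih
    · simpa using key 1 one_ne_zero y ih
  | inv_mul_cancel a ha y _ ih =>
    rcases ha with rfl | rfl
    · simpa using key' (-1) y ih
    · simpa using key (-1) (by simp) y ih

/-- The exponent sum of a generator of the free group of rank two. -/
def boolExp (b : Bool) : FreeGroup Bool →* Multiplicative ℤ :=
  FreeGroup.lift fun a => if a = b then .ofAdd 1 else 1

/-- An element that generates the free group of rank two together with the first generator and is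
homologous to the second generator is conjugate to it by a power of the first generator. -/
theorem exists_eq_conj_of_closure_eq_top {g : FreeGroup Bool}
    (hg : Subgroup.closure {of true, g} = ⊤) (h0 : boolExp true g = 1)
    (h1 : boolExp false g = .ofAdd 1) :
    ∃ k : ℤ, g = of true ^ k * of false * (of true ^ k)⁻¹ := by
  have e1 : boolExp false (of true) = 1 := by simp [boolExp]
  have e2 : boolExp false (of false) = .ofAdd 1 := by simp [boolExp]
  have e3 : boolExp true (of true) = .ofAdd 1 := by simp [boolExp]
  have e4 : boolExp true (of false) = 1 := by simp [boolExp]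
  rcases exists_eq_mul_isBounded_mul g with ⟨n, rfl⟩ | ⟨a, b, x, hx, rfl⟩
  · rw [map_zpow, e1, one_zpow] at h1
    exact absurd h1 (by decide)
  have hU : of false ∈ Subgroup.closure {of true, x} := by
    have hle : Subgroup.closure {of true, of true ^ a * x * of true ^ b} ≤
        Subgroup.closure {of true, x} := by
      rw [Subgroup.closure_le]
      have m1 : of true ∈ Subgroup.closure {of true, x} := Subgroup.subset_closure (by simp)
      have m2 : x ∈ Subgroup.closure {of true, x} := Subgroup.subset_closure (by simp)
      rintro y (rfl | rfl)
      · exact m1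
      · exact mul_mem (mul_mem (zpow_mem m1 _) m2) (zpow_mem m1 _)
    exact hle (by rw [hg]; trivial)
  rcases eq_zpow_or_isAlternating hU with ⟨n, hn⟩ | ⟨n, y, hy, hn⟩
  · have := congrArg (boolExp false) hn
    rw [map_zpow, e1, one_zpow, e2] at this
    exact absurd this (by decide)
  have hy' : y = of true ^ (-n) * of false := by rw [hn]; group
  have hcount : y.syllables = 1 := by
    rw [hy', syllables, toWord_mul_of_ne, List.countP_append, List.countP_eq_zero.2]
    · simp [toWord_of]
    · intro a ha
      simp [fst_of_mem_toWord_zpow _ ha]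
    · intro a ha b hb
      rw [fst_of_mem_toWord_zpow _ (List.mem_of_getLast? ha)]
      rw [toWord_of] at hb
      simp at hb
      simp [← hb]
  obtain ⟨m, b', hm⟩ := (hy.head_and_syllables hx).2.2.resolve_right (by omega)
  have hxe : boolExp false x = .ofAdd 1 := by simpa [e1] using h1
  obtain rfl : m = 1 := by
    have := congrArg (boolExp false) (hm.symm.trans hy')
    simp only [_root_.map_mul, map_zpow, e1, e2, hxe, one_zpow, mul_one, one_mul,
      ← ofAdd_zsmul] at this
    simpa using this
  have hx' : x = of true ^ (-n) * of false * of true ^ (-b') := by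
    rw [← hy', hm]
    group
  rw [hx'] at h0 ⊢
  simp only [_root_.map_mul, map_zpow, e3, e4, mul_one, ← ofAdd_zsmul, ← ofAdd_add,
    ofAdd_eq_one] at h0
  refine ⟨a - n, ?_⟩
  have hb : b = b' - (a - n) := by
    simp at h0
    omega
  rw [hb]
  group

end FreeGroup

namespace RAAG

variable {V : Type} {G : SimpleGraph V} {c : V}

theorem exists_zpow_mul_zpow {u : V} (huc : u ∈ _root_.star G c) {x : RAAG G}
    (hx : x ∈ par G {c, u}) : ∃ i j : ℤ, x = gen G c ^ i * gen G u ^ j := by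
  have hcomm := commute_gen_of_mem_star huc
  rw [par, Set.image_pair] at hx
  induction hx using Subgroup.closure_induction_left with
  | one => exact ⟨0, 0, by simp⟩
  | mul_left a ha y _ ih =>
    obtain ⟨i, j, rfl⟩ := ih
    rcases ha with rfl | rfl
    · exact ⟨1 + i, j, by rw [zpow_one_add, mul_assoc]⟩
    · refine ⟨i, 1 + j, ?_⟩
      rw [zpow_one_add, ← mul_assoc, ← mul_assoc, (hcomm.zpow_left i).eq]
  | inv_mul_cancel a ha y _ ih =>
    obtain ⟨i, j, rfl⟩ := ih
    rcases ha with rfl | rfl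
    · exact ⟨-1 + i, j, by rw [zpow_add, zpow_neg_one, mul_assoc]⟩
    · refine ⟨i, -1 + j, ?_⟩
      rw [zpow_add, zpow_neg_one, ← mul_assoc, ← mul_assoc, (hcomm.zpow_left i).inv_right.eq]

open Classical in
/-- The homomorphism to the free group of rank two recording two nonadjacent generators. -/
def toFree {u : V} (huc : ¬G.Adj c u) : RAAG G →* FreeGroup Bool :=
  lift (fun w => if w = c then .of true else if w = u then .of false else 1) fun v w hvw => by
    split_ifs with h1 h2 h3 h4 h5 h6 <;> try simp
    · subst h1; subst h3; exact absurd hvw huc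
    · subst h4; subst h5; exact absurd hvw.symm huc

/-- The homomorphism from the free group of rank two given by two generators. -/
def ofFree (G : SimpleGraph V) (c u : V) : FreeGroup Bool →* RAAG G :=
  FreeGroup.lift fun b => if b then gen G c else gen G u

section

variable {u : V} (huc : ¬G.Adj c u)

theorem toFree_gen_left : toFree huc (gen G c) = .of true := by simp [toFree]

theorem toFree_gen_right (hne : u ≠ c) : toFree huc (gen G u) = .of false := by
  simp [toFree, hne]

theorem toFree_gen_of_ne {w : V} (h1 : w ≠ c) (h2 : w ≠ u) : toFree huc (gen G w) = 1 := by
  simp [toFree, h1, h2]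

theorem ofFree_toFree (hne : u ≠ c) {x : RAAG G} (hx : x ∈ par G {c, u}) :
    ofFree G c u (toFree huc x) = x := by
  refine eqOn_par (f := (ofFree G c u).comp (toFree huc)) (g := MonoidHom.id _) ?_ hx
  rintro v (rfl | rfl)
  · simp [toFree_gen_left, ofFree]
  · simp [toFree_gen_right huc hne, ofFree]

theorem boolExp_toFree (hne : u ≠ c) (b : Bool) (x : RAAG G) :
    FreeGroup.boolExp b (toFree huc x) = expHom (if b then c else u) x := by
  have : (FreeGroup.boolExp b).comp (toFree huc) = expHom (if b then c else u) := by
    refine hom_ext fun v => ?_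
    rw [MonoidHom.comp_apply]
    by_cases h1 : v = c
    · subst h1
      rw [toFree_gen_left]
      cases b <;> simp [FreeGroup.boolExp, expHom, hne.symm]
    by_cases h2 : v = u
    · subst h2
      rw [toFree_gen_right huc hne]
      cases b <;> simp [FreeGroup.boolExp, expHom, hne]
    · rw [toFree_gen_of_ne huc h1 h2, map_one]
      cases b <;> simp [expHom, h1, h2]
  exact DFunLike.congr_fun this x

theorem toFree_mem_zpowers {w : V} (hwu : w ≠ u) {x : RAAG G} (hx : x ∈ par G {c, w}) :
    toFree huc x ∈ Subgroup.zpowers (FreeGroup.of true) := by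
  refine par_le (K := (Subgroup.zpowers (FreeGroup.of true)).comap (toFree huc)) ?_ hx
  have hc : gen G c ∈ (Subgroup.zpowers (FreeGroup.of true)).comap (toFree huc) := by
    rw [Subgroup.mem_comap, toFree_gen_left]
    exact Subgroup.mem_zpowers _
  rintro v (rfl | rfl)
  · exact hc
  · by_cases h1 : v = c
    · exact h1 ▸ hc
    · rw [Subgroup.mem_comap, toFree_gen_of_ne huc h1 hwu]
      exact one_mem _

end

theorem apply_gen_of_mem_star {ψ : MulAut (RAAG G)} (hψ : ∀ w x, expo w (ψ x) = expo w x)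
    (hpar : ∀ w, ψ (gen G w) ∈ par G {c, w}) {u : V} (huc : u ∈ _root_.star G c) :
    ψ (gen G u) = gen G u := by
  obtain ⟨i, j, h⟩ := exists_zpow_mul_zpow huc (hpar u)
  have h1 := hψ u (gen G u)
  have h2 := hψ c (gen G u)
  rw [h] at h1 h2 ⊢
  by_cases hu : u = c
  · subst hu
    have : i + j = 1 := by simpa using h1
    rw [← zpow_add, this, zpow_one]
  · have hi : i = 0 := by simpa [expo_gen_of_ne hu] using h2
    have hj : j = 1 := by simpa [expo_gen_of_ne (Ne.symm hu)] using h1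
    simp [hi, hj]

theorem exists_apply_gen_eq_conj {ψ : MulAut (RAAG G)} (hψ : ∀ w x, expo w (ψ x) = expo w x)
    (hpar : ∀ w, ψ (gen G w) ∈ par G {c, w}) {u : V} (huc : u ∉ _root_.star G c) :
    ∃ k : ℤ, ψ (gen G u) = gen G c ^ k * gen G u * (gen G c ^ k)⁻¹ := by
  rw [mem_star, not_or] at huc
  obtain ⟨hne, hadj⟩ := huc
  have htop : Subgroup.closure {FreeGroup.of true, toFree hadj (ψ (gen G u))} = ⊤ := by
    rw [eq_top_iff]
    have key (x : RAAG G) : toFree hadj x ∈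
        Subgroup.closure {FreeGroup.of true, toFree hadj (ψ (gen G u))} := by
      obtain ⟨y, rfl⟩ := ψ.surjective x
      refine hom_mem_of_gen ((toFree hadj).comp ψ.toMonoidHom) _ (fun w => ?_) y
      by_cases hw : w = u
      · subst hw
        exact Subgroup.subset_closure (by simp)
      · refine Subgroup.zpowers_le.2 ?_ (toFree_mem_zpowers hadj hw (hpar w))
        exact Subgroup.subset_closure (by simp)
    rw [← FreeGroup.closure_range_of, Subgroup.closure_le]
    rintro _ ⟨b, rfl⟩
    cases b
    · rw [← toFree_gen_right hadj hne]
      exact key _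
    · exact Subgroup.subset_closure (by simp)
  have hexp (w : V) : expHom w (ψ (gen G u)) = expHom w (gen G u) := hψ w _
  obtain ⟨k, hk⟩ := FreeGroup.exists_eq_conj_of_closure_eq_top htop
    (by rw [boolExp_toFree hadj hne, hexp]; simp [expHom, hne])
    (by rw [boolExp_toFree hadj hne, hexp]; simp [expHom])
  refine ⟨k, ?_⟩
  rw [← ofFree_toFree hadj hne (hpar u), hk]
  simp [ofFree]

theorem conj_exponent_eq_of_adj {ψ : MulAut (RAAG G)} {u w : V} (hu : u ∉ _root_.star G c)
    (hw : w ∉ _root_.star G c) (huw : G.Adj u w) {k l : ℤ}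
    (hk : ψ (gen G u) = gen G c ^ k * gen G u * (gen G c ^ k)⁻¹)
    (hl : ψ (gen G w) = gen G c ^ l * gen G w * (gen G c ^ l)⁻¹) : k = l := by
  rw [mem_star, not_or] at hu hw
  have hcomm := ((commute_gen huw).map ψ).map (MulAut.conj (gen G c ^ k)⁻¹)
  have hgu : gen G u ∈ par G {c}ᶜ := gen_mem_par hu.1
  have hgw : gen G w ∈ par G {c}ᶜ := gen_mem_par hw.1
  have h1 : MulAut.conj (gen G c ^ k)⁻¹ (ψ (gen G u)) = gen G u := by
    rw [hk, MulAut.conj_apply]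
    group
  have h2 : MulAut.conj (gen G c ^ k)⁻¹ (ψ (gen G w)) =
      gen G c ^ (l - k) * gen G w * (gen G c ^ (l - k))⁻¹ := by
    rw [hl, MulAut.conj_apply]
    group
  rw [h1, h2] at hcomm
  have h3 : gen G c ^ (l - k) * gen G w * (gen G c ^ (l - k))⁻¹ ∈ par G {c}ᶜ := by
    refine mem_par_compl_of_conj hu.2 hgu ?_ (by simp)
    rw [mul_assoc, hcomm.eq, inv_mul_cancel_left]
    exact hgu
  have h4 : (gen G c ^ (l - k))⁻¹ ∈ par G {c}ᶜ := by
    refine mem_par_compl_of_conj hw.2 hgw ?_ (by simp)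
    rwa [inv_inv]
  have h5 := expo_eq_zero_of_mem_par (w := c) (by simp) h4
  simp only [expo_inv, expo_zpow, expo_gen_self] at h5
  omega

theorem mem_pct_of_expo_apply [Fintype V] (hF : Focused G c) {φ : MulAut (RAAG G)}
    (hφ : ∀ w x, expo w (φ x) = expo w x) : φ ∈ PCT G := by
  obtain ⟨g, hg⟩ := exists_conj_apply_mem_par_pair hφ hF
  set ψ : MulAut (RAAG G) := MulAut.conj g⁻¹ * φ with hψ
  have happ (x : RAAG G) : ψ x = g⁻¹ * φ x * g := by simp [hψ]
  have hexp (w : V) (x : RAAG G) : expo w (ψ x) = expo w x := by rw [happ, expo_conj, hφ]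
  have hpar (w : V) : ψ (gen G w) ∈ par G {c, w} := by rw [happ]; exact hg w
  have hk (u : V) : ∃ k : ℤ, ψ (gen G u) = gen G c ^ k * gen G u * (gen G c ^ k)⁻¹ := by
    by_cases hu : u ∈ _root_.star G c
    · exact ⟨0, by simp [apply_gen_of_mem_star hexp hpar hu]⟩
    · exact exists_apply_gen_eq_conj hexp hpar hu
  choose k hk using hk
  obtain ⟨θ, hθ, hθ'⟩ := mem_pconjVectors (G := G) (v := c) (k := k)
    fun u w hu hw huw => conj_exponent_eq_of_adj hu hw huw (hk u) (hk w)
  have h1 : ψ = θ := aut_ext fun w => by rw [hk, hθ']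
  have h2 : φ = MulAut.conj g * θ := by
    rw [← h1, hψ, ← mul_assoc, ← map_mul, mul_inv_cancel, map_one, one_mul]
  rw [h2]
  exact mul_mem (inn_le_pct ⟨g, rfl⟩) hθ

theorem pct_eq_ker_diagHom [Fintype V] (hF : Focused G c) (hT : TrivialAut G) :
    PCT G = (diagHom hF hT).ker := by
  classical
  refine le_antisymm (pct_le_ker_diagHom hF hT) fun φ hφ => ?_
  have hdiag (v : V) : expo v (φ (gen G v)) = 1 := congrFun (MonoidHom.mem_ker.1 hφ) v
  set j : V → ℤ := fun v => if v = c then 0 else -linMat φ v c with hj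
  obtain ⟨hjc, τ, hτ, hτ'⟩ := mem_transVectors (G := G) (c := c) (j := j) (by simp [hj])
    fun v hv => by
      by_cases hvc : v = c
      · simp [hj, hvc] at hv
      · exact (linMat_ne_zero_imp hF hT φ (by simpa [hj, hvc] using hv) (Ne.symm hvc)).2
  have hoff (v w : V) (hwv : w ≠ v) (hwc : w ≠ c) : expo w (φ (gen G v)) = 0 := by
    by_contra h
    exact hwc (linMat_ne_zero_imp hF hT φ h hwv).1
  have key (w v : V) : expo w ((φ * τ) (gen G v)) = expo w (gen G v) := by
    rw [MulAut.mul_apply, hτ', map_mul, map_zpow, expo_mul, expo_zpow]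
    by_cases hwc : w = c
    · subst hwc
      rw [hdiag, mul_one]
      by_cases hv : v = w
      · subst hv; simp [hj, hdiag]
      · simp [hj, hv, linMat_apply, expo_gen_of_ne hv]
    · rw [hoff c w hwc hwc, mul_zero, zero_add]
      by_cases hv : v = w
      · subst hv; rw [hdiag, expo_gen_self]
      · rw [hoff v w (Ne.symm hv) hwc, expo_gen_of_ne hv]
  have hIA (w : V) (x : RAAG G) : expo w ((φ * τ) x) = expo w x := by
    have : (expHom w).comp (φ * τ).toMonoidHom = expHom w := hom_ext fun v => key w v
    exact DFunLike.congr_fun this x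
  exact (Subgroup.mul_mem_cancel_right _ hτ).1 (mem_pct_of_expo_apply hF hIA)

theorem diagHom_signAut [Fintype V] (hF : Focused G c) (hT : TrivialAut G) (ε : V → ℤˣ) (v : V) :
    diagHom hF hT (signAut G ε) v = ε v := by
  simp [diagHom_apply]

theorem nonempty_units_int_mulEquiv : Nonempty (ℤˣ ≃* Multiplicative (ZMod 2)) := by
  have h1 : Nat.card ℤˣ = 2 := by rw [Nat.card_eq_fintype_card, Fintype.card_units_int]
  have : IsCyclic ℤˣ := isCyclic_of_prime_card (p := 2) h1
  exact ⟨mulEquivOfCyclicCardEq (by rw [h1, Nat.card_eq_fintype_card]; simp)⟩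

theorem nonempty_invSubgroup_mulEquiv [Fintype V] (G : SimpleGraph V) :
    Nonempty (InvSubgroup G ≃* Multiplicative (Fin (Nat.card V) → ZMod 2)) := by
  obtain ⟨e⟩ := nonempty_units_int_mulEquiv
  have e1 := (MulEquiv.subgroupCongr (range_signAut (G := G))).symm.trans
    (MonoidHom.ofInjective signAut_injective).symm
  have e2 : (V → ℤˣ) ≃* (Fin (Nat.card V) → Multiplicative (ZMod 2)) :=
    MulEquiv.arrowCongr (Finite.equivFin V) e
  exact ⟨(e1.trans e2).trans (MulEquiv.funMultiplicative _ _).symm⟩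

end RAAG

/-- For a focused graph, `Aut(A_Γ) ≅ PCT ⋊ I_Γ` with `I_Γ ≅ (ℤ/2)^n`, and
`Inn(A_Γ) ≤ PCT`. -/
theorem stmt18 {V : Type} [Fintype V] (G : SimpleGraph V) (c : V)
    (hF : Focused G c) (hT : TrivialAut G) :
    (PCT G).Normal ∧
    Nonempty (InvSubgroup G ≃* Multiplicative (Fin (Nat.card V) → ZMod 2)) ∧
    PCT G ⊓ InvSubgroup G = ⊥ ∧
    PCT G ⊔ InvSubgroup G = ⊤ ∧
    Inn (RAAG G) ≤ PCT G := by
  have hker := RAAG.pct_eq_ker_diagHom hF hT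
  refine ⟨?_, RAAG.nonempty_invSubgroup_mulEquiv G, ?_, ?_, RAAG.inn_le_pct⟩
  · rw [hker]
    infer_instance
  · rw [eq_bot_iff, hker, ← RAAG.range_signAut]
    rintro _ ⟨h, ε, rfl⟩
    have : ε = 1 := by
      ext v
      rw [← RAAG.diagHom_signAut hF hT, MonoidHom.mem_ker.1 h]
      simp
    rw [this, map_one]
    exact one_mem _
  · rw [eq_top_iff]
    intro φ _
    have h1 : ∀ v, ∃ u : ℤˣ, (u : ℤ) = RAAG.diagHom hF hT φ v := by
      intro v
      rcases RAAG.diagHom_eq_one_or_neg_one hF hT φ v with h | h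
      · exact ⟨1, by simp [h]⟩
      · exact ⟨-1, by simp [h]⟩
    choose ε hε using h1
    have h2 : RAAG.diagHom hF hT φ = RAAG.diagHom hF hT (RAAG.signAut G ε) :=
      funext fun v => by rw [RAAG.diagHom_signAut, hε]
    rw [← inv_mul_cancel_right φ (RAAG.signAut G ε)]
    refine Subgroup.mul_mem_sup ?_ ?_
    · rw [hker, MonoidHom.mem_ker, map_mul, h2, ← map_mul, mul_inv_cancel, map_one]
    · rw [← RAAG.range_signAut]
      exact ⟨ε, rfl⟩
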